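/- arXiv:2208.12560 — 6 statements merged into one kernel-verified Lean document; each statement's English description precedes it below -/
import Mathlib

section
/- Let R be a commutative ring, let A be an m×n matrix with entries in R, and let c < min(m, n) be such that every (c+1)×(c+1) minor of A vanishes. Suppose α = {α₁, …, α_c} ⊆ {1, …, m} is a collection of c rows of A for which there exist c columns such that the corresponding c×c minor μ of A is formed from the rows α. Then in the localization R_μ = R[1/μ], every row of A can be written as an R_μ-linear combination of the rows A_{α₁}, …, A_{α_c}, and the coefficients of this linear combination are unique. -/
/-- If all minors of size `card k` with distinct rows and columns vanish, so do those with
repetitions. -/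
theorem Matrix.det_submatrix_eq_zero_of_injective {R l o k p : Type*} [CommRing R]
    [Fintype k] [DecidableEq k] [Fintype p] [DecidableEq p] (e : p ≃ k) (A : Matrix l o R)
    (h : ∀ (f : p → l) (g : p → o), Function.Injective f → Function.Injective g →
      (A.submatrix f g).det = 0) (f : k → l) (g : k → o) :
    (A.submatrix f g).det = 0 := by
  by_cases hf : Function.Injective f
  · by_cases hg : Function.Injective g
    · rw [← Matrix.det_submatrix_equiv_self e, Matrix.submatrix_submatrix]
      exact h _ _ (hf.comp e.injective) (hg.comp e.injective)
    · simp only [Function.Injective, not_forall] at hg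
      obtain ⟨a, b, hab, hne⟩ := hg
      exact Matrix.det_zero_of_column_eq hne fun t => by simp [hab]
  · simp only [Function.Injective, not_forall] at hf
    obtain ⟨a, b, hab, hne⟩ := hf
    exact Matrix.det_zero_of_row_eq hne (by ext t; simp [hab])

/-- Cramer's rule: if a square submatrix is invertible and all minors bordering it vanish, every
row is a unique linear combination of the rows of the submatrix. -/
theorem Matrix.existsUnique_row_combination {S l o k : Type*} [CommRing S]
    [Fintype k] [DecidableEq k] (B : Matrix l o S) (α : k → l) (β : k → o)
    (hu : IsUnit (B.submatrix α β).det) (i : l)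
    (h : ∀ j, (B.submatrix (Sum.elim α fun _ : Unit => i)
      (Sum.elim β fun _ : Unit => j)).det = 0) :
    ∃! lam : k → S, ∀ j, B i j = ∑ t, lam t * B (α t) j := by
  let M := B.submatrix α β
  let _ : Invertible M := Matrix.invertibleOfIsUnitDet M hu
  let C : Matrix Unit k S := B.submatrix (fun _ => i) β
  refine ⟨(C * ⅟M) (), fun j => ?_, fun lam hlam => ?_⟩
  · have hj := h j
    have hblocks : B.submatrix (Sum.elim α fun _ : Unit => i) (Sum.elim β fun _ : Unit => j) =
        Matrix.fromBlocks M (B.submatrix α fun _ => j) C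
          (B.submatrix (fun _ => i) fun _ => j) := by
      ext (a | a) (b | b) <;> rfl
    rw [hblocks, Matrix.det_fromBlocks₁₁, hu.mul_right_eq_zero, Matrix.det_unique] at hj
    exact sub_eq_zero.mp hj
  · have hC : C = Matrix.of (fun _ : Unit => lam) * M := by
      ext a b
      exact hlam (β b)
    rw [hC, Matrix.mul_invOf_cancel_right]
    rfl

/-- Cramer's-rule lemma: if all (c+1)×(c+1) minors of an m×n matrix A over a commutative ring
R vanish, and μ is the c×c minor of A formed from the rows α (and some columns β), then in the
localization R_μ every row of A is a unique R_μ-linear combination of the rows A_{α₁},…,A_{α_c}. -/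
theorem stmt0 {R : Type*} [CommRing R] {m n c : ℕ} (hc : c < min m n)
    (A : Matrix (Fin m) (Fin n) R)
    (hminors : ∀ (f : Fin (c+1) → Fin m) (g : Fin (c+1) → Fin n),
      Function.Injective f → Function.Injective g → (A.submatrix f g).det = 0)
    (α : Fin c → Fin m) (hα : Function.Injective α)
    (β : Fin c → Fin n) (hβ : Function.Injective β)
    (μ : R) (hμ : μ = (A.submatrix α β).det)
    (i : Fin m) :
    ∃! lam : Fin c → Localization.Away μ,
      ∀ j : Fin n, algebraMap R (Localization.Away μ) (A i j) =
        ∑ t, lam t * algebraMap R (Localization.Away μ) (A (α t) j) := by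
  let φ := algebraMap R (Localization.Away μ)
  refine Matrix.existsUnique_row_combination (A.map φ) α β ?_ i fun j => ?_
  · rw [Matrix.submatrix_map, ← RingHom.mapMatrix_apply, ← RingHom.map_det, ← hμ]
    exact IsLocalization.Away.algebraMap_isUnit μ
  · have e : Fin (c + 1) ≃ Fin c ⊕ Unit := Fintype.equivOfCardEq (by simp)
    rw [Matrix.submatrix_map, ← RingHom.mapMatrix_apply, ← RingHom.map_det,
      Matrix.det_submatrix_eq_zero_of_injective e A hminors, map_zero]
end

section
/- Let x ∈ ℂ^{n+1} satisfy g₁(x) = … = g_k(x) = 0 and F(x) ≠ 0, and suppose the matrix J_g(x) has rank c. Then the set {η ∈ ℂ^{n+1} : every minor of size c+1 of A(x,η) vanishes} is exactly the affine subspace (1/F(x))∇F(x) + RowSpan(J_g(x)) of ℂ^{n+1}, where RowSpan(J_g(x)) denotes the ℂ-linear span of the rows of J_g(x); in particular this set is an affine subspace of dimension c. (This is the fiberwise content of the statement that the projection π₁ : 𝓘 → C_X° from the incidence variety of critical points is a vector bundle of rank c = codim_{ℙⁿ}(X).) -/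
open MvPolynomial

/-- Gradient of a multivariate polynomial at a point. -/
noncomputable def grad {n : ℕ} (P : MvPolynomial (Fin (n+1)) ℂ) (x : Fin (n+1) → ℂ) :
    Fin (n+1) → ℂ := fun j => eval x (pderiv j P)

/-- The k×(n+1) Jacobian matrix of g₁,…,g_k at x. -/
noncomputable def Jmat {n k : ℕ} (g : Fin k → MvPolynomial (Fin (n+1)) ℂ)
    (x : Fin (n+1) → ℂ) : Matrix (Fin k) (Fin (n+1)) ℂ :=
  Matrix.of fun i j => grad (g i) x j

/-- The (k+1)×(n+1) matrix A(x,η) with first row (1/F(x))∇F(x) − η and remaining rows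
the rows of the Jacobian of g₁,…,g_k. -/
noncomputable def Amat {n k : ℕ} (F : MvPolynomial (Fin (n+1)) ℂ)
    (g : Fin k → MvPolynomial (Fin (n+1)) ℂ) (x η : Fin (n+1) → ℂ) :
    Matrix (Fin (k+1)) (Fin (n+1)) ℂ :=
  Matrix.of (Fin.cons (fun j => (eval x F)⁻¹ * grad F x j - η j) (fun i => grad (g i) x))

/-- All minors of size r of M vanish. -/
def minorsVanish {m N : ℕ} (r : ℕ) (M : Matrix (Fin m) (Fin N) ℂ) : Prop :=
  ∀ (f : Fin r → Fin m) (s : Fin r → Fin N),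
    Function.Injective f → Function.Injective s → (M.submatrix f s).det = 0

/-- A matrix of rank at least `r` over a field has `r` linearly independent rows. -/
lemma exists_linearIndependent_rows_of_le_rank {K m N : Type*} [Field K] [Finite m] [Fintype N]
    (M : Matrix m N K) {r : ℕ} (h : r ≤ M.rank) :
    ∃ f : Fin r → m, Function.Injective f ∧ LinearIndependent K fun i => M (f i) := by
  rw [M.rank_eq_finrank_span_row] at h
  obtain ⟨v, hv, -, hli⟩ :=
    Submodule.exists_fun_fin_finrank_span_eq K (Set.range M.row)
  choose f hf using hv
  have hli' : LinearIndependent K fun i : Fin r => M (f (Fin.castLE h i)) := by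
    have h_eq : (fun i : Fin r => M (f (Fin.castLE h i))) = v ∘ Fin.castLE h :=
      funext fun i => hf _
    rw [h_eq]
    exact hli.comp _ (Fin.castLE_injective h)
  exact ⟨fun i => f (Fin.castLE h i), fun a b hab => hli'.injective (congrArg M hab), hli'⟩

/-- The determinantal characterization of rank: the minors of size `r` vanish iff the rank is
less than `r`. -/
lemma minorsVanish_iff_rank_lt {m N r : ℕ} (M : Matrix (Fin m) (Fin N) ℂ) :
    minorsVanish r M ↔ M.rank < r := by
  constructor
  · intro h
    by_contra! hr
    obtain ⟨f, hf, hfli⟩ := exists_linearIndependent_rows_of_le_rank M hr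
    have hrank : r ≤ (M.submatrix f id).transpose.rank := by
      rw [Matrix.rank_transpose]
      have hcard := LinearIndependent.rank_matrix (M := M.submatrix f id) hfli
      rw [hcard, Fintype.card_fin]
    obtain ⟨s, hs, hsli⟩ := exists_linearIndependent_rows_of_le_rank _ hrank
    have hunit : IsUnit (M.submatrix f s).transpose :=
      Matrix.linearIndependent_rows_iff_isUnit.mp hsli
    rw [Matrix.isUnit_iff_isUnit_det, Matrix.det_transpose, h f s hf hs] at hunit
    exact not_isUnit_zero hunit
  · intro h f s _ _
    by_contra hdet
    have hrank := Matrix.rank_of_det_ne_zero hdet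
    rw [Fintype.card_fin] at hrank
    exact absurd (M.rank_submatrix_le f s) (by lia)

/-- Adjoining a vector to a finite-dimensional span does not raise its dimension iff the vector
already lies in the span. -/
lemma finrank_span_insert_le_iff {K V : Type*} [Field K] [AddCommGroup V] [Module K V]
    [FiniteDimensional K V] (w : V) (s : Set V) :
    Module.finrank K (Submodule.span K (insert w s)) ≤ Module.finrank K (Submodule.span K s) ↔
      w ∈ Submodule.span K s := by
  constructor
  · intro h
    rw [Submodule.eq_of_le_of_finrank_le (Submodule.span_mono (Set.subset_insert w s)) h]
    exact Submodule.subset_span (Set.mem_insert w s)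
  · intro h
    rw [Submodule.span_insert_eq_span h]

/-- For x on the punctured cone at which the Jacobian has rank c, the set of η for which all
(c+1)×(c+1) minors of A(x,η) vanish is exactly the affine subspace
(1/F(x))∇F(x) + RowSpan(J_g(x)), an affine subspace of dimension c. -/
theorem stmt1 {n k c d : ℕ} (hc : c ≤ min k n) (hd : 1 ≤ d)
    (g : Fin k → MvPolynomial (Fin (n+1)) ℂ) (F : MvPolynomial (Fin (n+1)) ℂ)
    (hg : ∀ i, ∃ m, (g i).IsHomogeneous m) (hF : F.IsHomogeneous d)
    (x : Fin (n+1) → ℂ)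
    (hgx : ∀ i, eval x (g i) = 0) (hFx : eval x F ≠ 0)
    (hrank : (Jmat g x).rank = c) :
    {η : Fin (n+1) → ℂ | minorsVanish (c+1) (Amat F g x η)} =
      {η : Fin (n+1) → ℂ | ∃ v ∈ Submodule.span ℂ (Set.range fun i => grad (g i) x),
        η = (fun j => (eval x F)⁻¹ * grad F x j) + v} ∧
    Module.finrank ℂ (Submodule.span ℂ (Set.range fun i => grad (g i) x)) = c := by
  have hfin : Module.finrank ℂ (Submodule.span ℂ (Set.range fun i => grad (g i) x)) = c := by
    rw [← hrank, Matrix.rank_eq_finrank_span_row]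
    rfl
  refine ⟨?_, hfin⟩
  ext η
  have hrow : Set.range (Amat F g x η).row =
      insert (fun j => (eval x F)⁻¹ * grad F x j - η j) (Set.range fun i => grad (g i) x) :=
    Fin.range_cons _ _
  rw [Set.mem_ofPred_eq, Set.mem_ofPred_eq, minorsVanish_iff_rank_lt, Nat.lt_succ_iff,
    Matrix.rank_eq_finrank_span_row, hrow, ← hfin, finrank_span_insert_le_iff]
  constructor
  · intro h
    refine ⟨_, Submodule.neg_mem _ h, ?_⟩
    ext j
    simp
  · rintro ⟨v, hv, rfl⟩
    convert Submodule.neg_mem _ hv using 1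
    ext j
    simp
end

section
/- Let η ∈ ℂ^{n+1} and let x ∈ ℂ^{n+1} satisfy g₁(x) = … = g_k(x) = 0 and F(x) ≠ 0. Suppose J_g(x) has rank c and every minor of size c+1 of A(x,η) vanishes. Then η·x = d. (That is, every critical point of the log likelihood function ℓ_{F,η}(x) = log F(x) − η·x on the smooth part of the affine cone over V(g₁,…,g_k) away from V(F) lies on the affine hyperplane {x : η·x = deg F}.) -/
open MvPolynomial

/-- The values of a finite family contain a basis of its span, indexed by `Fin r`, where `r` is the
dimension of the span. -/
theorem exists_fin_linearIndependent_comp {K V ι : Type*} [Field K] [AddCommGroup V] [Module K V]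
    [Finite ι] (v : ι → V) {r : ℕ}
    (hr : Module.finrank K (Submodule.span K (Set.range v)) = r) :
    ∃ f : Fin r → ι, Function.Injective f ∧
      Submodule.span K (Set.range (v ∘ f)) = Submodule.span K (Set.range v) ∧
      LinearIndependent K (v ∘ f) := by
  obtain ⟨κ, a, ha, hspan, hli⟩ := exists_linearIndependent' K v
  have : Finite κ := Finite.of_injective a ha
  have := Fintype.ofFinite κ
  have hcard : Fintype.card κ = r := by
    rw [← hr, ← hspan]
    exact (finrank_span_eq_card hli).symm
  let e : Fin r ≃ κ := (Fintype.equivFinOfCardEq hcard).symm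
  refine ⟨a ∘ e, ha.comp e.injective, ?_, hli.comp e e.injective⟩
  rw [← hspan, ← Function.comp_assoc, e.surjective.range_comp]

/-- A matrix with linearly independent rows has a nonzero maximal minor. -/
theorem Matrix.exists_submatrix_det_ne_zero {K n : Type*} [Field K] [Fintype n] {r : ℕ}
    (M : Matrix (Fin r) n K) (hM : LinearIndependent K M.row) :
    ∃ s : Fin r → n, Function.Injective s ∧ (M.submatrix id s).det ≠ 0 := by
  have hr : Module.finrank K (Submodule.span K (Set.range M.col)) = r := by
    rw [← M.rank_eq_finrank_span_cols, hM.rank_matrix, Fintype.card_fin]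
  obtain ⟨s, hs, -, hli⟩ := exists_fin_linearIndependent_comp M.col hr
  refine ⟨s, hs, ?_⟩
  have hunit : IsUnit (M.submatrix id s) :=
    Matrix.linearIndependent_cols_iff_isUnit.mp hli
  exact ((Matrix.isUnit_iff_isUnit_det _).mp hunit).ne_zero

/-- Euler's identity, evaluated at a point. -/
theorem grad_dotProduct_self {n m : ℕ} {P : MvPolynomial (Fin (n+1)) ℂ} (hP : P.IsHomogeneous m)
    (x : Fin (n+1) → ℂ) : grad P x ⬝ᵥ x = m * eval x P := by
  have h := congrArg (eval x) hP.sum_X_mul_pderiv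
  simpa [dotProduct, grad, mul_comm] using h

/-- If the minors of size `c + 1` of `A` vanish, where `c` is the rank of the Jacobian, then the
first row of `A` lies in the row space of the Jacobian. -/
theorem Amat_zero_mem_span {n k c : ℕ} (g : Fin k → MvPolynomial (Fin (n+1)) ℂ)
    (F : MvPolynomial (Fin (n+1)) ℂ) (η x : Fin (n+1) → ℂ) (hrank : (Jmat g x).rank = c)
    (hmin : minorsVanish (c+1) (Amat F g x η)) :
    Amat F g x η 0 ∈ Submodule.span ℂ (Set.range (Jmat g x).row) := by
  by_contra hmem
  rw [Matrix.rank_eq_finrank_span_row] at hrank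
  obtain ⟨f, hf, hspan, hli⟩ := exists_fin_linearIndependent_comp (Jmat g x).row hrank
  let f' : Fin (c+1) → Fin (k+1) := Fin.cons 0 (Fin.succ ∘ f)
  have hf' : Function.Injective f' :=
    Fin.cons_injective_iff.mpr
      ⟨by rintro ⟨i, hi⟩; exact Fin.succ_ne_zero _ hi, (Fin.succ_injective k).comp hf⟩
  have hrows : ((Amat F g x η).submatrix f' id).row =
      Fin.cons (Amat F g x η 0) ((Jmat g x).row ∘ f) := by
    funext i
    cases i using Fin.cases <;> rfl
  obtain ⟨s, hs, hdet⟩ := ((Amat F g x η).submatrix f' id).exists_submatrix_det_ne_zero (by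
    rw [hrows, linearIndependent_finCons, hspan]
    exact ⟨hli, hmem⟩)
  exact hdet (hmin f' s hf' hs)

/-- Every critical point of ℓ_{F,η} on the smooth part of the punctured affine cone lies on the
affine hyperplane {x : η·x = deg F}. -/
theorem stmt5 {n k c d : ℕ} (hc : c ≤ min k n) (hd : 1 ≤ d)
    (g : Fin k → MvPolynomial (Fin (n+1)) ℂ) (F : MvPolynomial (Fin (n+1)) ℂ)
    (hg : ∀ i, ∃ m, (g i).IsHomogeneous m) (hF : F.IsHomogeneous d)
    (η x : Fin (n+1) → ℂ)
    (hgx : ∀ i, eval x (g i) = 0) (hFx : eval x F ≠ 0)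
    (hrank : (Jmat g x).rank = c)
    (hmin : minorsVanish (c+1) (Amat F g x η)) :
    ∑ j, η j * x j = (d : ℂ) := by
  have hmem := Amat_zero_mem_span g F η x hrank hmin
  have horth : Submodule.span ℂ (Set.range (Jmat g x).row) ≤
      LinearMap.ker (dotProductBilin ℂ ℂ |>.flip x) := by
    rw [Submodule.span_le]
    rintro _ ⟨i, rfl⟩
    obtain ⟨m, hm⟩ := hg i
    change grad (g i) x ⬝ᵥ x = 0
    rw [grad_dotProduct_self hm, hgx i, mul_zero]
  have hzero : ((eval x F)⁻¹ • grad F x - η) ⬝ᵥ x = 0 := horth hmem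
  rw [sub_dotProduct, smul_dotProduct, grad_dotProduct_self hF, smul_eq_mul, mul_left_comm,
    inv_mul_cancel₀ hFx, mul_one, sub_eq_zero] at hzero
  exact hzero.symm
end

section
/- Assume the ideal ⟨g₁, …, g_k⟩ ⊆ ℂ[x₀, …, xₙ] is prime and does not contain F, and assume that for every x ∈ ℂ^{n+1} with g₁(x) = … = g_k(x) = 0 and F(x) ≠ 0 the matrix J_g(x) has rank c. Fix a nonzero η ∈ ℂ^{n+1}. In the localization L = ℂ[x₀, …, xₙ][1/F], let A denote the (k+1)×(n+1) matrix over L whose first row is (1/F)∇F − η (with ∇F the row of partial derivatives of F) and remaining rows the gradients ∇g₁, …, ∇g_k, and let B denote the (k+2)×(n+1) matrix over L whose rows are (1/F)∇F, η, ∇g₁, …, ∇g_k. Let I_A ⊆ L be the ideal generated by g₁, …, g_k together with all minors of size c+1 of A, and let I_B ⊆ L be the ideal generated by g₁, …, g_k, the element η·x − d, and all minors of size c+2 of B. Then I_A = I_B. (Equivalently, the projectivization map induces an isomorphism between the scheme of critical points of ℓ_{F,η} on the punctured affine cone C_X° and the scheme of critical points of log f_{F,η} on X ∖ D_{F,η}.)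 -/
open MvPolynomial

/-- The (k+1)×(n+1) matrix A over the localization L = ℂ[x₀,…,xₙ][1/F], whose first row is
(1/F)∇F − η and whose remaining rows are the gradients ∇g₁, …, ∇g_k. -/
noncomputable def AmatL {n k : ℕ} (F : MvPolynomial (Fin (n+1)) ℂ)
    (g : Fin k → MvPolynomial (Fin (n+1)) ℂ) (η : Fin (n+1) → ℂ) :
    Matrix (Fin (k+1)) (Fin (n+1)) (Localization.Away F) :=
  Matrix.of (Fin.cons
    (fun j => IsLocalization.Away.invSelf (S := Localization.Away F) F *
        algebraMap (MvPolynomial (Fin (n+1)) ℂ) (Localization.Away F) (pderiv j F) -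
      algebraMap (MvPolynomial (Fin (n+1)) ℂ) (Localization.Away F) (C (η j)))
    (fun i j => algebraMap (MvPolynomial (Fin (n+1)) ℂ) (Localization.Away F) (pderiv j (g i))))

/-- The (k+2)×(n+1) matrix B over the localization L = ℂ[x₀,…,xₙ][1/F], whose rows are
(1/F)∇F, η, ∇g₁, …, ∇g_k. -/
noncomputable def BmatL {n k : ℕ} (F : MvPolynomial (Fin (n+1)) ℂ)
    (g : Fin k → MvPolynomial (Fin (n+1)) ℂ) (η : Fin (n+1) → ℂ) :
    Matrix (Fin (k+2)) (Fin (n+1)) (Localization.Away F) :=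
  Matrix.of (Fin.cons
    (fun j => IsLocalization.Away.invSelf (S := Localization.Away F) F *
        algebraMap (MvPolynomial (Fin (n+1)) ℂ) (Localization.Away F) (pderiv j F))
    (Fin.cons
      (fun j => algebraMap (MvPolynomial (Fin (n+1)) ℂ) (Localization.Away F) (C (η j)))
      (fun i j => algebraMap (MvPolynomial (Fin (n+1)) ℂ) (Localization.Away F) (pderiv j (g i)))))

/-- The set of all minors of size r of a matrix M. -/
def minorsSet {m N : ℕ} (r : ℕ) {R : Type*} [CommRing R] (M : Matrix (Fin m) (Fin N) R) :
    Set R :=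
  {z | ∃ (f : Fin r → Fin m) (s : Fin r → Fin N),
    Function.Injective f ∧ Function.Injective s ∧ z = (M.submatrix f s).det}

section RowMinor

variable {R : Type*} [CommRing R] {N r : ℕ}

/-- The minor in the columns `s` of the matrix with rows `v`. -/
def rowMinor (v : Fin r → Fin N → R) (s : Fin r → Fin N) : R :=
  (Matrix.of fun i j => v i (s j)).det

theorem det_submatrix_eq_rowMinor {m : ℕ} (M : Matrix (Fin m) (Fin N) R) (f : Fin r → Fin m)
    (s : Fin r → Fin N) : (M.submatrix f s).det = rowMinor (fun i => M.row (f i)) s := rfl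

theorem map_rowMinor {S : Type*} [CommRing S] (φ : R →+* S) (v : Fin r → Fin N → R)
    (s : Fin r → Fin N) : φ (rowMinor v s) = rowMinor (fun i j => φ (v i j)) s := by
  rw [rowMinor, RingHom.map_det]
  rfl

theorem rowMinor_eq_zero_of_row_eq {v : Fin r → Fin N → R} {i j : Fin r} (hij : i ≠ j)
    (h : v i = v j) (s : Fin r → Fin N) : rowMinor v s = 0 :=
  Matrix.det_zero_of_row_eq hij (by ext; simp [h])

theorem rowMinor_eq_zero_of_not_injective {m : ℕ} (w : Fin m → Fin N → R) {f : Fin r → Fin m}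
    (hf : ¬ Function.Injective f) (s : Fin r → Fin N) : rowMinor (fun i => w (f i)) s = 0 := by
  obtain ⟨i, j, h, hij⟩ := Function.not_injective_iff.1 hf
  exact rowMinor_eq_zero_of_row_eq hij (by simp [h]) s

theorem rowMinor_eq_zero_of_col_eq (v : Fin r → Fin N → R) {s : Fin r → Fin N}
    (hs : ¬ Function.Injective s) : rowMinor v s = 0 := by
  obtain ⟨i, j, h, hij⟩ := Function.not_injective_iff.1 hs
  exact Matrix.det_zero_of_column_eq hij (by simp [h])

theorem rowMinor_comp_perm (v : Fin r → Fin N → R) (σ : Equiv.Perm (Fin r)) (s : Fin r → Fin N) :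
    rowMinor (fun i => v (σ i)) s = (Equiv.Perm.sign σ : R) * rowMinor v s :=
  Matrix.det_permute σ (Matrix.of fun i j => v i (s j))

theorem rowMinor_update_add (v : Fin r → Fin N → R) (i : Fin r) (a b : Fin N → R)
    (s : Fin r → Fin N) : rowMinor (Function.update v i (a + b)) s =
      rowMinor (Function.update v i a) s + rowMinor (Function.update v i b) s := by
  have key (w : Fin N → R) : (Matrix.of fun p j => Function.update v i w p (s j)) =
      (Matrix.of fun p j => v p (s j)).updateRow i (fun j => w (s j)) := by
    ext p j
    by_cases h : p = i
    · subst h; simp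
    · simp [h]
  simp only [rowMinor, key]
  exact Matrix.det_updateRow_add _ _ _ _

theorem rowMinor_cons_sub (v : Fin r → Fin N → R) (a b : Fin N → R) (s : Fin (r + 1) → Fin N) :
    rowMinor (Fin.cons (a - b) v : Fin (r + 1) → Fin N → R) s =
      rowMinor (Fin.cons a v : Fin (r + 1) → Fin N → R) s -
        rowMinor (Fin.cons b v : Fin (r + 1) → Fin N → R) s := by
  have h := rowMinor_update_add (Fin.cons a v : Fin (r + 1) → Fin N → R) 0 (a - b) b s
  simp only [sub_add_cancel, Fin.update_cons_zero] at h
  rw [h, add_sub_cancel_right]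

theorem rowMinor_eq_zero_of_succAbove {v : Fin (r + 1) → Fin N → R} (i : Fin (r + 1))
    (h : ∀ t, rowMinor (fun p => v (i.succAbove p)) t = 0) (s : Fin (r + 1) → Fin N) :
    rowMinor v s = 0 := by
  rw [rowMinor, Matrix.det_succ_row _ i]
  refine Finset.sum_eq_zero fun j _ => ?_
  have := h (fun q => s (j.succAbove q))
  rw [rowMinor] at this
  exact mul_eq_zero_of_right _ this

/-- Contraction of the maximal minors of a matrix against a vector `x`. -/
theorem sum_mul_rowMinor_cons (v : Fin (r + 1) → Fin N → R) (x : Fin N → R) (s : Fin r → Fin N) :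
    ∑ a, x a * rowMinor v (Fin.cons a s) =
      ∑ i : Fin (r + 1), (-1) ^ (i : ℕ) * (∑ a, v i a * x a) * rowMinor (fun p => v (i.succAbove p)) s := by
  simp only [rowMinor, Matrix.det_succ_column_zero, Finset.mul_sum, Finset.sum_mul]
  rw [Finset.sum_comm]
  refine Finset.sum_congr rfl fun i _ => Finset.sum_congr rfl fun a _ => ?_
  simp only [Matrix.of_apply, Fin.cons_zero]
  have : (Matrix.of fun p j => v p ((Fin.cons a s : Fin (r + 1) → Fin N) j)).submatrix
      i.succAbove Fin.succ = Matrix.of fun p j => v (i.succAbove p) (s j) := by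
    ext; simp
  rw [this]
  ring

variable {k : ℕ} {J : Fin k → Fin N → R} {u η x : Fin N → R}

theorem rowMinor_cons_eq_zero_of_forall (w : Fin N → R)
    (hJ : ∀ (f : Fin (r + 1) → Fin k) s, rowMinor (fun i => J (f i)) s = 0)
    (hw : ∀ (h : Fin r → Fin k) s,
      rowMinor (Fin.cons w (fun i => J (h i)) : Fin (r + 1) → Fin N → R) s = 0)
    (f : Fin (r + 1) → Fin (k + 1)) (s : Fin (r + 1) → Fin N) :
    rowMinor (fun i => (Fin.cons w J : Fin (k + 1) → Fin N → R) (f i)) s = 0 := by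
  by_cases hf : Function.Injective f
  swap
  · exact rowMinor_eq_zero_of_not_injective _ hf s
  by_cases h0 : ∃ i, f i = 0
  · obtain ⟨i, hi⟩ := h0
    have hne (p : Fin r) : f (Equiv.swap 0 i p.succ) ≠ 0 := fun h => by
      have := hf (h.trans hi.symm)
      rw [Equiv.swap_apply_eq_iff, Equiv.swap_apply_right] at this
      exact Fin.succ_ne_zero _ this
    choose h hh using fun p => Fin.exists_succ_eq.2 (hne p)
    have key := rowMinor_comp_perm
      (fun i => (Fin.cons w J : Fin (k + 1) → Fin N → R) (f i)) (Equiv.swap 0 i) s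
    have : (fun p => (Fin.cons w J : Fin (k + 1) → Fin N → R) (f (Equiv.swap 0 i p))) =
        Fin.cons w (fun p => J (h p)) := by
      funext p
      refine Fin.cases ?_ (fun p => ?_) p
      · simp [hi]
      · rw [← hh p]; simp
    rw [this, hw] at key
    rcases Int.units_eq_one_or (Equiv.Perm.sign (Equiv.swap 0 i)) with h1 | h1 <;>
      simpa [h1] using key.symm
  · push Not at h0
    choose h hh using fun p => Fin.exists_succ_eq.2 (h0 p)
    simp only [← hh, Fin.cons_succ]
    exact hJ _ _

/-- If the minors of size `r + 1` of the matrix with rows `u - η, J` vanish, then so do the minors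
of size `r + 2` of the matrix with rows `u, η, J`. -/
theorem rowMinor_cons_cons_eq_zero
    (hA : ∀ (f : Fin (r + 1) → Fin (k + 1)) s,
      rowMinor (fun i => (Fin.cons (u - η) J : Fin (k + 1) → Fin N → R) (f i)) s = 0)
    (f : Fin (r + 2) → Fin (k + 2)) (s : Fin (r + 2) → Fin N) :
    rowMinor (fun i => (Fin.cons u (Fin.cons η J : Fin (k + 1) → Fin N → R) :
      Fin (k + 2) → Fin N → R) (f i)) s = 0 := by
  set M : Fin (k + 2) → Fin N → R :=
    Fin.cons (u - η) (Fin.cons η J : Fin (k + 1) → Fin N → R) with hM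
  have hM0 (f : Fin (r + 2) → Fin (k + 2)) : rowMinor (fun i => M (f i)) s = 0 := by
    by_cases hf : Function.Injective f
    swap
    · exact rowMinor_eq_zero_of_not_injective _ hf s
    obtain ⟨i, hi⟩ : ∃ i : Fin (r + 2), ∀ p : Fin (r + 1), f (i.succAbove p) ≠ 1 := by
      by_cases h1 : ∃ i, f i = 1
      · obtain ⟨i, hi⟩ := h1
        exact ⟨i, fun p hp => Fin.succAbove_ne i p (hf (hp.trans hi.symm))⟩
      · push Not at h1
        exact ⟨0, fun p => h1 _⟩
    refine rowMinor_eq_zero_of_succAbove i (fun t => ?_) s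
    choose h hh using fun p : Fin (r + 1) => Fin.exists_succAbove_eq (hi p)
    rw [← hA h t]
    congr 1
    funext p
    rw [← hh p]
    refine Fin.cases ?_ (fun q => ?_) (h p)
    · simp [hM]
    · have : Fin.succAbove (1 : Fin (k + 2)) q.succ = q.succ.succ := by
        rw [← Fin.succ_zero_eq_one, Fin.succ_succAbove_succ, Fin.succAbove_zero]
      simp [hM, this]
  by_cases hf : Function.Injective f
  swap
  · exact rowMinor_eq_zero_of_not_injective _ hf s
  by_cases h0 : ∃ i, f i = 0
  · obtain ⟨i, hi⟩ := h0
    have h1 : (fun p => (Fin.cons u (Fin.cons η J : Fin (k + 1) → Fin N → R) :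
        Fin (k + 2) → Fin N → R) (f p)) =
        Function.update (fun p => M (f p)) i ((u - η) + η) := by
      funext p
      by_cases hp : p = i
      · subst hp; simp [hi]
      · have : f p ≠ 0 := fun h => hp (hf (h.trans hi.symm))
        obtain ⟨q, hq⟩ := Fin.exists_succ_eq.2 this
        simp [hp, ← hq, hM]
    have h2 : Function.update (fun p => M (f p)) i (u - η) = fun p => M (f p) := by
      rw [Function.update_eq_self_iff]
      simp [hi, hM]
    have h3 : Function.update (fun p => M (f p)) i η =
        fun p => M (Function.update f i 1 p) := by
      funext p
      by_cases hp : p = i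
      · subst hp
        rw [Function.update_self, Function.update_self, hM, ← Fin.succ_zero_eq_one, Fin.cons_succ,
          Fin.cons_zero]
      · simp [hp]
    rw [h1, rowMinor_update_add, h2, h3, hM0, hM0, add_zero]
  · push Not at h0
    rw [← hM0 f]
    congr 1
    funext p
    obtain ⟨q, hq⟩ := Fin.exists_succ_eq.2 (h0 p)
    simp [← hq, hM]

theorem dotProduct_mul_rowMinor_eq_zero (hx : ∀ i, ∑ a, J i a * x a = 0) {w : Fin N → R}
    (h : Fin r → Fin k)
    (hA : ∀ s, rowMinor (Fin.cons w (fun i => J (h i)) : Fin (r + 1) → Fin N → R) s = 0)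
    (s : Fin r → Fin N) : (∑ a, w a * x a) * rowMinor (fun i => J (h i)) s = 0 := by
  have := sum_mul_rowMinor_cons (Fin.cons w (fun i => J (h i)) : Fin (r + 1) → Fin N → R) x s
  simpa [Fin.sum_univ_succ, hA, hx] using this.symm

theorem rowMinor_cons_sub_eq_zero (hx : ∀ i, ∑ a, J i a * x a = 0) {e : R} (he : IsUnit e)
    (hu : ∑ a, u a * x a = e) (hη : ∑ a, η a * x a = e) (h : Fin r → Fin k)
    (hB : ∀ s, rowMinor (Fin.cons u (Fin.cons η (fun i => J (h i)) : Fin (r + 1) → Fin N → R) :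
      Fin (r + 2) → Fin N → R) s = 0) (s : Fin (r + 1) → Fin N) :
    rowMinor (Fin.cons (u - η) (fun i => J (h i)) : Fin (r + 1) → Fin N → R) s = 0 := by
  have key := sum_mul_rowMinor_cons (Fin.cons u (Fin.cons η (fun i => J (h i)) :
    Fin (r + 1) → Fin N → R) : Fin (r + 2) → Fin N → R) x s
  have h1 : (fun p => (Fin.cons u (Fin.cons η (fun i => J (h i)) : Fin (r + 1) → Fin N → R) :
      Fin (r + 2) → Fin N → R) (Fin.succAbove 1 p)) = Fin.cons u (fun i => J (h i)) := by
    funext p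
    refine Fin.cases ?_ (fun q => ?_) p
    · simp
    · have : Fin.succAbove (1 : Fin (r + 2)) q.succ = q.succ.succ := by
        rw [← Fin.succ_zero_eq_one, Fin.succ_succAbove_succ, Fin.succAbove_zero]
      simp [this]
  simp only [Fin.sum_univ_succ (n := r + 1), Fin.sum_univ_succ (n := r), hB, Fin.cons_succ, hx,
    Fin.cons_zero, hu, hη, Fin.succAbove_zero, Fin.succ_zero_eq_one, h1] at key
  rw [rowMinor_cons_sub]
  refine (he.mul_right_eq_zero).1 ?_
  simp only [mul_zero, zero_mul, Finset.sum_const_zero, Fin.val_zero, Fin.val_one, pow_zero,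
    pow_one, add_zero, one_mul] at key
  linear_combination key

end RowMinor

section Rank

variable {K : Type*} [Field K]

theorem exists_linearIndependent_rows {k N : ℕ} (M : Matrix (Fin k) (Fin N) K) :
    ∃ f : Fin M.rank → Fin k, Function.Injective f ∧
      LinearIndependent K (M.submatrix f id).row := by
  obtain ⟨κ, a, ha, hsp, hli⟩ := exists_linearIndependent' K M.row
  have := Finite.of_injective a ha
  have := Fintype.ofFinite κ
  have hcard : Fintype.card κ = M.rank := by
    rw [M.rank_eq_finrank_span_row, ← hsp, linearIndependent_iff_card_eq_finrank_span.1 hli]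
    rfl
  let e := (Fintype.equivFinOfCardEq hcard).symm
  exact ⟨a ∘ e, ha.comp e.injective, hli.comp e e.injective⟩

theorem exists_rowMinor_ne_zero {k N c : ℕ} (M : Matrix (Fin k) (Fin N) K) (hM : M.rank = c) :
    ∃ (f : Fin c → Fin k) (s : Fin c → Fin N), rowMinor (fun i => M (f i)) s ≠ 0 := by
  subst hM
  obtain ⟨f, -, hf⟩ := exists_linearIndependent_rows M
  have hr : (M.submatrix f id).transpose.rank = M.rank := by
    rw [Matrix.rank_transpose, hf.rank_matrix, Fintype.card_fin]
  obtain ⟨s, -, hs⟩ := exists_linearIndependent_rows (M.submatrix f id).transpose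
  generalize (M.submatrix f id).transpose.rank = q at hr s hs
  subst hr
  refine ⟨f, s, ?_⟩
  have := (Matrix.isUnit_iff_isUnit_det _).1 (Matrix.linearIndependent_rows_iff_isUnit.1 hs)
  rw [← Matrix.det_transpose] at this
  exact this.ne_zero

theorem rowMinor_eq_zero_of_rank_lt {k N r : ℕ} (M : Matrix (Fin k) (Fin N) K) (hM : M.rank < r)
    (f : Fin r → Fin k) (s : Fin r → Fin N) : rowMinor (fun i => M (f i)) s = 0 := by
  by_contra h
  have h1 := Matrix.rank_of_det_ne_zero (A := M.submatrix f s) h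
  have h2 := M.rank_submatrix_le f s
  rw [h1, Fintype.card_fin] at h2
  omega

end Rank

theorem mk_det_submatrix_eq_zero {R : Type*} [CommRing R] {m N r : ℕ} {M : Matrix (Fin m) (Fin N) R}
    {I : Ideal R} (hI : minorsSet r M ⊆ I) (f : Fin r → Fin m) (s : Fin r → Fin N) :
    Ideal.Quotient.mk I (M.submatrix f s).det = 0 := by
  by_cases hf : Function.Injective f
  · by_cases hs : Function.Injective s
    · exact Ideal.Quotient.eq_zero_iff_mem.2 (hI ⟨f, s, hf, hs, rfl⟩)
    · rw [det_submatrix_eq_rowMinor, rowMinor_eq_zero_of_col_eq _ hs, map_zero]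
  · rw [det_submatrix_eq_rowMinor, rowMinor_eq_zero_of_not_injective M.row hf, map_zero]

section Critical

variable {n k c : ℕ} {g : Fin k → MvPolynomial (Fin (n + 1)) ℂ}
  {F : MvPolynomial (Fin (n + 1)) ℂ}

theorem eval_rowMinor_pderiv {r : ℕ} (f : Fin r → Fin k) (s : Fin r → Fin (n + 1))
    (x : Fin (n + 1) → ℂ) :
    eval x (rowMinor (fun i j => pderiv j (g (f i))) s) =
      rowMinor (fun i => (Matrix.of fun i j => eval x (pderiv j (g i)) :
        Matrix (Fin k) (Fin (n + 1)) ℂ) (f i)) s :=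
  map_rowMinor (eval x) _ s

theorem rowMinor_pderiv_mem_span (hprime : (Ideal.span (Set.range g)).IsPrime)
    (hFnotin : F ∉ Ideal.span (Set.range g))
    (hrank : ∀ x : Fin (n + 1) → ℂ, (∀ i, eval x (g i) = 0) → eval x F ≠ 0 →
      (Matrix.of fun i j => eval x (pderiv j (g i)) : Matrix (Fin k) (Fin (n + 1)) ℂ).rank = c)
    (f : Fin (c + 1) → Fin k) (s : Fin (c + 1) → Fin (n + 1)) :
    rowMinor (fun i j => pderiv j (g (f i))) s ∈ Ideal.span (Set.range g) := by
  have h : F * rowMinor (fun i j => pderiv j (g (f i))) s ∈ Ideal.span (Set.range g) := by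
    rw [← IsPrime.vanishingIdeal_zeroLocus (K := ℂ) (Ideal.span (Set.range g)),
      mem_vanishingIdeal_iff]
    intro x hx
    rw [mem_zeroLocus_iff] at hx
    have hgx (i) : eval x (g i) = 0 := by
      simpa [aeval_eq_eval] using hx _ (Ideal.subset_span ⟨i, rfl⟩)
    by_cases hF : eval x F = 0
    · simp [aeval_eq_eval, hF]
    · simp only [aeval_eq_eval, map_mul, eval_rowMinor_pderiv]
      rw [rowMinor_eq_zero_of_rank_lt _ (by rw [hrank x hgx hF]; exact c.lt_succ_self), mul_zero]
  exact (hprime.mem_or_mem h).resolve_left hFnotin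

/-- A power of `F` lies in the ideal generated by the `g i` and the minors of size `c` of their
Jacobian matrix. -/
theorem mem_radical_span_rowMinor_pderiv
    (hrank : ∀ x : Fin (n + 1) → ℂ, (∀ i, eval x (g i) = 0) → eval x F ≠ 0 →
      (Matrix.of fun i j => eval x (pderiv j (g i)) : Matrix (Fin k) (Fin (n + 1)) ℂ).rank = c) :
    F ∈ (Ideal.span (Set.range g ∪ {p | ∃ (f : Fin c → Fin k) (s : Fin c → Fin (n + 1)),
      p = rowMinor (fun i j => pderiv j (g (f i))) s})).radical := by
  rw [← vanishingIdeal_zeroLocus_eq_radical (K := ℂ), mem_vanishingIdeal_iff]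
  intro x hx
  rw [mem_zeroLocus_iff] at hx
  by_contra hF
  obtain ⟨f, s, hfs⟩ := exists_rowMinor_ne_zero _ (hrank x
    (fun i => by simpa [aeval_eq_eval] using hx _ (Ideal.subset_span (Or.inl ⟨i, rfl⟩)))
    (by simpa [aeval_eq_eval] using hF))
  rw [← eval_rowMinor_pderiv] at hfs
  exact hfs (by simpa [aeval_eq_eval] using hx _ (Ideal.subset_span (Or.inr ⟨f, s, rfl⟩)))

variable {Q : Type*} [CommRing Q] {φ : MvPolynomial (Fin (n + 1)) ℂ →+* Q}

theorem rowMinor_map_pderiv_eq_zero (hprime : (Ideal.span (Set.range g)).IsPrime)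
    (hFnotin : F ∉ Ideal.span (Set.range g))
    (hrank : ∀ x : Fin (n + 1) → ℂ, (∀ i, eval x (g i) = 0) → eval x F ≠ 0 →
      (Matrix.of fun i j => eval x (pderiv j (g i)) : Matrix (Fin k) (Fin (n + 1)) ℂ).rank = c)
    (hφ : ∀ i, φ (g i) = 0) (f : Fin (c + 1) → Fin k) (s : Fin (c + 1) → Fin (n + 1)) :
    rowMinor (fun i j => φ (pderiv j (g (f i)))) s = 0 := by
  rw [← map_rowMinor φ (fun i j => pderiv j (g (f i)))]
  have hle : Ideal.span (Set.range g) ≤ RingHom.ker φ := by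
    rw [Ideal.span_le]
    rintro _ ⟨i, rfl⟩
    exact hφ i
  exact hle (rowMinor_pderiv_mem_span hprime hFnotin hrank f s)

theorem eq_zero_of_mul_rowMinor_map_pderiv
    (hrank : ∀ x : Fin (n + 1) → ℂ, (∀ i, eval x (g i) = 0) → eval x F ≠ 0 →
      (Matrix.of fun i j => eval x (pderiv j (g i)) : Matrix (Fin k) (Fin (n + 1)) ℂ).rank = c)
    (hφ : ∀ i, φ (g i) = 0) (hF : IsUnit (φ F)) {z : Q}
    (hz : ∀ (f : Fin c → Fin k) s, z * rowMinor (fun i j => φ (pderiv j (g (f i)))) s = 0) :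
    z = 0 := by
  obtain ⟨m, hm⟩ := mem_radical_span_rowMinor_pderiv hrank
  have hle : Ideal.span (Set.range g ∪ {p | ∃ (f : Fin c → Fin k) (s : Fin c → Fin (n + 1)),
      p = rowMinor (fun i j => pderiv j (g (f i))) s}) ≤
      Ideal.comap φ (LinearMap.ker (LinearMap.toSpanSingleton Q Q z)) := by
    rw [Ideal.span_le]
    rintro _ (⟨i, rfl⟩ | ⟨f, s, rfl⟩)
    · simp [hφ]
    · simpa [map_rowMinor, mul_comm] using hz f s
  have := hle hm
  rw [Ideal.mem_comap, LinearMap.mem_ker, LinearMap.toSpanSingleton_apply, map_pow,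
    smul_eq_mul] at this
  exact ((hF.pow m).mul_right_eq_zero).1 this

theorem sum_map_pderiv_mul_X {p : MvPolynomial (Fin (n + 1)) ℂ} {m : ℕ} (hp : p.IsHomogeneous m) :
    ∑ a, φ (pderiv a p) * φ (X a) = m * φ p := by
  have := congrArg φ hp.sum_X_mul_pderiv
  simpa [mul_comm] using this

variable (g F) in
theorem map_det_submatrix_AmatL (ψ : Localization.Away F →+* Q) (η : Fin (n + 1) → ℂ) {r : ℕ}
    (f : Fin r → Fin (k + 1)) (s : Fin r → Fin (n + 1)) :
    ψ ((AmatL F g η).submatrix f s).det =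
      rowMinor (fun i => (Fin.cons
        ((fun j => ψ (IsLocalization.Away.invSelf F) * ψ (algebraMap (MvPolynomial (Fin (n + 1)) ℂ) _ (pderiv j F))) -
          fun j => ψ (algebraMap (MvPolynomial (Fin (n + 1)) ℂ) _ (C (η j))))
        (fun i j => ψ (algebraMap (MvPolynomial (Fin (n + 1)) ℂ) _ (pderiv j (g i)))) :
          Fin (k + 1) → Fin (n + 1) → Q) (f i)) s := by
  rw [det_submatrix_eq_rowMinor, map_rowMinor]
  congr 1
  funext i j
  refine Fin.cases ?_ (fun p => ?_) (f i) <;> simp [AmatL]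

variable (g F) in
theorem map_det_submatrix_BmatL (ψ : Localization.Away F →+* Q) (η : Fin (n + 1) → ℂ) {r : ℕ}
    (f : Fin r → Fin (k + 2)) (s : Fin r → Fin (n + 1)) :
    ψ ((BmatL F g η).submatrix f s).det =
      rowMinor (fun i => (Fin.cons
        (fun j => ψ (IsLocalization.Away.invSelf F) * ψ (algebraMap (MvPolynomial (Fin (n + 1)) ℂ) _ (pderiv j F)))
        (Fin.cons (fun j => ψ (algebraMap (MvPolynomial (Fin (n + 1)) ℂ) _ (C (η j))))
          (fun i j => ψ (algebraMap (MvPolynomial (Fin (n + 1)) ℂ) _ (pderiv j (g i)))) : Fin (k + 1) → Fin (n + 1) → Q) :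
          Fin (k + 2) → Fin (n + 1) → Q) (f i)) s := by
  rw [det_submatrix_eq_rowMinor, map_rowMinor]
  congr 1
  funext i j
  refine Fin.cases ?_ (fun p => Fin.cases ?_ (fun q => ?_) p) (f i) <;> simp [BmatL]

theorem sum_map_logDeriv_mul_X {d : ℕ} (ψ : Localization.Away F →+* Q) (hF : F.IsHomogeneous d) :
    ∑ a, ψ (IsLocalization.Away.invSelf F) * ψ (algebraMap (MvPolynomial (Fin (n + 1)) ℂ) _ (pderiv a F)) *
      ψ (algebraMap (MvPolynomial (Fin (n + 1)) ℂ) _ (X a)) = d := by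
  have h := sum_map_pderiv_mul_X (φ := ψ.comp (algebraMap (MvPolynomial (Fin (n + 1)) ℂ) _)) hF
  have h1 := congrArg ψ (IsLocalization.Away.mul_invSelf (S := Localization.Away F) F)
  simp only [RingHom.comp_apply, map_mul, map_one] at h h1
  simp only [mul_assoc, ← Finset.mul_sum, h]
  linear_combination (d : Q) * h1

end Critical

/-- Theorem 3.5: the ideal I_A of critical points of ℓ_{F,η} on the punctured cone equals the
ideal I_B of critical points of log f_{F,η} in the chart η·x = d, as ideals of
L = ℂ[x₀,…,xₙ][1/F]. -/
theorem stmt6 {n k c d : ℕ} (hc : c ≤ min k n) (hd : 1 ≤ d)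
    (g : Fin k → MvPolynomial (Fin (n+1)) ℂ) (F : MvPolynomial (Fin (n+1)) ℂ)
    (hg : ∀ i, ∃ m, (g i).IsHomogeneous m) (hF : F.IsHomogeneous d)
    (hprime : (Ideal.span (Set.range g)).IsPrime)
    (hFnotin : F ∉ Ideal.span (Set.range g))
    (hrank : ∀ x : Fin (n+1) → ℂ, (∀ i, eval x (g i) = 0) → eval x F ≠ 0 →
      (Matrix.of fun i j => eval x (pderiv j (g i)) : Matrix (Fin k) (Fin (n+1)) ℂ).rank = c)
    (η : Fin (n+1) → ℂ) (hη : η ≠ 0) :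
    Ideal.span
      ((Set.range fun i => algebraMap (MvPolynomial (Fin (n+1)) ℂ) (Localization.Away F) (g i)) ∪
        minorsSet (c+1) (AmatL F g η)) =
    Ideal.span
      ((Set.range fun i => algebraMap (MvPolynomial (Fin (n+1)) ℂ) (Localization.Away F) (g i)) ∪
        {algebraMap (MvPolynomial (Fin (n+1)) ℂ) (Localization.Away F)
          ((∑ j, C (η j) * X j) - C (d : ℂ))} ∪
        minorsSet (c+2) (BmatL F g η)) := by
  set ι := algebraMap (MvPolynomial (Fin (n+1)) ℂ) (Localization.Away F)
  set IA := Ideal.span ((Set.range fun i => ι (g i)) ∪ minorsSet (c+1) (AmatL F g η)) with hIA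
  set IB := Ideal.span ((Set.range fun i => ι (g i)) ∪ {ι ((∑ j, C (η j) * X j) - C (d : ℂ))} ∪
    minorsSet (c+2) (BmatL F g η)) with hIB
  have hgA (i) : ι (g i) ∈ IA := Ideal.subset_span (Or.inl ⟨i, rfl⟩)
  have hgB (i) : ι (g i) ∈ IB := Ideal.subset_span (Or.inl (Or.inl ⟨i, rfl⟩))
  have hFu : IsUnit (ι F) := IsLocalization.Away.algebraMap_isUnit F
  have hJx {Q : Type} [CommRing Q] (ψ : Localization.Away F →+* Q) (hψ : ∀ i, ψ (ι (g i)) = 0)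
      (i : Fin k) : ∑ a, ψ (ι (pderiv a (g i))) * ψ (ι (X a)) = 0 := by
    obtain ⟨m, hm⟩ := hg i
    simpa [hψ] using sum_map_pderiv_mul_X (φ := ψ.comp ι) hm
  apply le_antisymm
  · rw [hIA, Ideal.span_le]
    rintro _ (⟨i, rfl⟩ | ⟨f, s, -, -, rfl⟩)
    · exact hgB i
    set ψ := Ideal.Quotient.mk IB
    have hψ (i) : ψ (ι (g i)) = 0 := Ideal.Quotient.eq_zero_iff_mem.2 (hgB i)
    have hd' : IsUnit (ψ (ι (C (d : ℂ)))) :=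
      (((Nat.cast_ne_zero.2 (by omega : d ≠ 0)).isUnit.map C).map ι).map ψ
    have hdψ : ψ (ι (C (d : ℂ))) = d := by simp
    have hηx : ∑ a, ψ (ι (C (η a))) * ψ (ι (X a)) = d := by
      have : ψ (ι ((∑ j, C (η j) * X j) - C (d : ℂ))) = 0 :=
        Ideal.Quotient.eq_zero_iff_mem.2 (Ideal.subset_span (Or.inl (Or.inr rfl)))
      rw [map_sub, map_sub, hdψ, sub_eq_zero] at this
      simpa using this
    rw [SetLike.mem_coe, ← Ideal.Quotient.eq_zero_iff_mem, map_det_submatrix_AmatL]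
    refine rowMinor_cons_eq_zero_of_forall _
      (rowMinor_map_pderiv_eq_zero (φ := ψ.comp ι) hprime hFnotin hrank hψ) (fun h s => ?_) f s
    refine rowMinor_cons_sub_eq_zero (hJx ψ hψ) (hdψ ▸ hd') (sum_map_logDeriv_mul_X ψ hF) hηx h
      (fun t => ?_) s
    have key := mk_det_submatrix_eq_zero (I := IB) (M := BmatL F g η)
      (fun _ hz => Ideal.subset_span (Or.inr hz))
      (Fin.cons 0 (Fin.cons 1 (fun i => (h i).succ.succ) : Fin (c + 1) → Fin (k + 2))) t
    rw [map_det_submatrix_BmatL] at key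
    rw [← key]
    congr 1
    funext p
    refine Fin.cases ?_ (fun p => Fin.cases ?_ (fun q => ?_) p) p <;> rfl
  · set ψ := Ideal.Quotient.mk IA
    have hψ (i) : ψ (ι (g i)) = 0 := Ideal.Quotient.eq_zero_iff_mem.2 (hgA i)
    have hA (f : Fin (c + 1) → Fin (k + 1)) (s : Fin (c + 1) → Fin (n + 1)) :
        ψ ((AmatL F g η).submatrix f s).det = 0 :=
      mk_det_submatrix_eq_zero (fun _ hz => Ideal.subset_span (Or.inr hz)) f s
    simp only [map_det_submatrix_AmatL] at hA
    rw [hIB, Ideal.span_le]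
    rintro _ ((⟨i, rfl⟩ | rfl) | ⟨f, s, -, -, rfl⟩)
    · exact hgA i
    · rw [SetLike.mem_coe, ← Ideal.Quotient.eq_zero_iff_mem, ← neg_eq_zero]
      refine eq_zero_of_mul_rowMinor_map_pderiv (φ := ψ.comp ι) hrank hψ (hFu.map ψ)
        fun f s => ?_
      have key := dotProduct_mul_rowMinor_eq_zero (hJx ψ hψ)
        (w := (fun j => ψ (IsLocalization.Away.invSelf F) * ψ (ι (pderiv j F))) -
          fun j => ψ (ι (C (η j)))) f (fun t => ?_) s
      · have hz : -ψ (ι ((∑ j, C (η j) * X j) - C (d : ℂ))) =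
            d - ∑ a, ψ (ι (C (η a))) * ψ (ι (X a)) := by
          simp only [map_sub, map_sum, map_mul, map_natCast, neg_sub]
        simp only [Pi.sub_apply, sub_mul _ _ (ψ (ι (X _))), Finset.sum_sub_distrib] at key
        rw [sum_map_logDeriv_mul_X ψ hF] at key
        rw [hz]
        exact key
      · rw [← hA (Fin.cons 0 (fun i => (f i).succ)) t]
        congr 1
        funext p
        refine Fin.cases ?_ (fun q => ?_) p <;> rfl
    · rw [SetLike.mem_coe, ← Ideal.Quotient.eq_zero_iff_mem, map_det_submatrix_BmatL]
      exact rowMinor_cons_cons_eq_zero hA f s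
end

section
/- Assume the ideal ⟨g₁, …, g_k⟩ ⊆ ℂ[x₀, …, xₙ] is prime and does not contain F, and assume that for every x ∈ ℂ^{n+1} with g₁(x) = … = g_k(x) = 0 and F(x) ≠ 0 the matrix J_g(x) has rank c. For η ∈ ℂ^{n+1}, let Crit(η) = {x ∈ ℂ^{n+1} : g₁(x) = … = g_k(x) = 0, F(x) ≠ 0, and every minor of size c+1 of A(x,η) vanishes}, the set of critical points of ℓ_{F,η} on the punctured affine cone. Then there exists a nonzero polynomial h ∈ ℂ[η₀, …, ηₙ] such that for all η, η′ ∈ ℂ^{n+1} with h(η) ≠ 0 and h(η′) ≠ 0, the sets Crit(η) and Crit(η′) are finite and have the same cardinality. (This number is the maximum likelihood degree MLD_X(F).) -/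
open MvPolynomial

/-- The set of critical points of ℓ_{F,η} on the punctured affine cone. -/
noncomputable def Crit {n k : ℕ} (c : ℕ) (g : Fin k → MvPolynomial (Fin (n+1)) ℂ)
    (F : MvPolynomial (Fin (n+1)) ℂ) (η : Fin (n+1) → ℂ) : Set (Fin (n+1) → ℂ) :=
  {x | (∀ i, eval x (g i) = 0) ∧ eval x F ≠ 0 ∧ minorsVanish (c+1) (Amat F g x η)}

/-- The chain rule for a derivation applied to the value of a polynomial. -/
theorem Derivation.map_mvPolynomial_aeval {k M N σ : Type*} [CommRing k] [CommRing M] [Algebra k M]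
    [AddCommGroup N] [Module k N] [Module M N] [Fintype σ] [IsScalarTower k M N]
    (D : Derivation k M N) (x : σ → M) (p : MvPolynomial σ k) :
    D (aeval x p) = ∑ j, aeval x (pderiv j p) • D (x j) := by
  classical
  induction p using MvPolynomial.induction_on with
  | C a => simp
  | add p q hp hq => simp [hp, hq, add_smul, Finset.sum_add_distrib]
  | mul_X p i hp =>
    simp only [map_mul, aeval_X, Derivation.leibniz, hp, smul_eq_mul, map_add, pderiv_X, add_smul,
      Finset.sum_add_distrib, Finset.smul_sum, mul_smul]
    congr 1
    simp [Pi.single_apply, apply_ite (aeval x)]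

/-- A point at which `c` polynomials vanish with nonzero Jacobian minor is algebraic over any field
containing the remaining coordinates. -/
theorem isAlgebraic_of_jacobian_minor_ne_zero {k L σ : Type*} [Field k] [Field L] [Algebra k L]
    [Fintype σ] {c : ℕ} (x : σ → L) (g : Fin c → MvPolynomial σ k) (s : Fin c → σ)
    (hg : ∀ i, aeval x (g i) = 0)
    (hdet : (Matrix.of fun i j => aeval x (pderiv (s j) (g i))).det ≠ 0)
    (K : IntermediateField k L) (hK : ∀ j, j ∉ Set.range s → x j ∈ K) (j : σ) :
    IsAlgebraic K (x j) := by
  classical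
  let M := IntermediateField.adjoin K (Set.range x)
  have hx : ∀ j, x j ∈ M := fun j => IntermediateField.subset_adjoin _ _ ⟨j, rfl⟩
  let y : σ → M := fun j => ⟨x j, hx j⟩
  have hy : ∀ p : MvPolynomial σ k, ((aeval y p : M) : L) = aeval x p := by
    intro p
    have : IsScalarTower k M L := .of_algebraMap_eq fun _ => rfl
    have := (IsScalarTower.toAlgHom k M L).comp_apply (aeval y) p
    rw [MvPolynomial.comp_aeval] at this
    exact this.symm
  have hsinj : Function.Injective s := by
    intro a b hab
    by_contra hne
    exact hdet (Matrix.det_zero_of_column_eq hne (by simp [hab]))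
  let D := KaehlerDifferential.D K M
  have hDK : ∀ j, j ∉ Set.range s → D (y j) = 0 := by
    intro j hj
    exact D.map_algebraMap (⟨x j, hK j hj⟩ : K)
  have hrel : ∀ i, ∑ l, (aeval y (pderiv (s l) (g i)) : M) • D (y (s l)) = 0 := by
    intro i
    have h1 := (D.restrictScalars k).map_mvPolynomial_aeval y (g i)
    have h0 : (aeval y (g i) : M) = 0 := by
      apply Subtype.ext; rw [hy, hg]; rfl
    rw [h0, map_zero] at h1
    rw [← Finset.sum_image (s := Finset.univ) (g := s)
      (f := fun j => (aeval y (pderiv j (g i)) : M) • D (y j)) hsinj.injOn]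
    rw [h1]
    apply Finset.sum_subset (Finset.subset_univ _)
    intro j _ hj
    rw [hDK j (by simpa using hj), smul_zero]
  let J : Matrix (Fin c) (Fin c) M := Matrix.of fun i l => aeval y (pderiv (s l) (g i))
  have hJ : IsUnit J.det := by
    rw [isUnit_iff_ne_zero]
    intro h
    apply hdet
    have := congrArg (algebraMap M L) h
    rw [RingHom.map_det, map_zero] at this
    rw [← this]
    congr 1
    ext i l
    exact (hy _).symm
  have hDs : ∀ l, D (y (s l)) = 0 := by
    intro l
    have : ∑ m, ((J⁻¹ * J) l m) • D (y (s m)) = 0 := by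
      simp_rw [Matrix.mul_apply, Finset.sum_smul, mul_smul]
      rw [Finset.sum_comm]
      simp_rw [← Finset.smul_sum]
      exact Finset.sum_eq_zero fun i _ => by rw [show ∑ m, J i m • D (y (s m)) = 0 from hrel i,
        smul_zero]
    rw [Matrix.nonsing_inv_mul _ hJ] at this
    simpa [Matrix.one_apply] using this
  have hDy : ∀ j, D (y j) = 0 := by
    intro j
    by_cases hj : j ∈ Set.range s
    · obtain ⟨l, rfl⟩ := hj; exact hDs l
    · exact hDK j hj
  have hD : ∀ m (hm : m ∈ M), D ⟨m, hm⟩ = 0 := by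
    intro m hm
    induction hm using IntermediateField.adjoin_induction with
    | mem z hz => obtain ⟨j, rfl⟩ := hz; exact hDy j
    | algebraMap z => exact D.map_algebraMap z
    | add a b ha hb h1 h2 =>
      have := D.map_add ⟨a, ha⟩ ⟨b, hb⟩
      rw [h1, h2, add_zero] at this; exact this
    | inv a ha h1 =>
      have := D.leibniz_inv ⟨a, ha⟩
      rw [h1, smul_zero] at this; exact this
    | mul a b ha hb h1 h2 =>
      have := D.leibniz ⟨a, ha⟩ ⟨b, hb⟩
      rw [h1, h2, smul_zero, smul_zero, add_zero] at this; exact this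
  have hunr : Algebra.FormallyUnramified K M := by
    constructor
    rw [← Submodule.subsingleton_iff M, ← subsingleton_iff_bot_eq_top, eq_comm, eq_bot_iff,
      ← KaehlerDifferential.span_range_derivation, Submodule.span_le]
    rintro _ ⟨⟨m, hm⟩, rfl⟩
    exact hD m hm
  have : Algebra.EssFiniteType K M := by
    rw [IntermediateField.essFiniteType_iff]
    exact ⟨(Set.range x).toFinset, by simp [M]⟩
  have := Algebra.FormallyUnramified.isSeparable K M
  have halg : IsAlgebraic K (y j) := Algebra.IsAlgebraic.isAlgebraic _
  exact halg.algebraMap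

theorem Matrix.exists_submatrix_det_ne_zero_of_rank {K : Type*} [Field K] {k m c : ℕ}
    (A : Matrix (Fin k) (Fin m) K) (h : A.rank = c) :
    ∃ (r : Fin c → Fin k) (s : Fin c → Fin m), (A.submatrix r s).det ≠ 0 := by
  have key : ∀ {k m : ℕ} (A : Matrix (Fin k) (Fin m) K), A.rank = c →
      ∃ r : Fin c → Fin k, LinearIndependent K (A.submatrix r id).row := by
    intro k m A h
    rw [Matrix.rank_eq_finrank_span_row] at h
    subst h
    obtain ⟨f, hf, -, hli⟩ := Submodule.exists_fun_fin_finrank_span_eq K (Set.range A.row)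
    choose r hr using hf
    exact ⟨r, (funext hr : (A.submatrix r id).row = f) ▸ hli⟩
  obtain ⟨r, hr⟩ := key A h
  obtain ⟨s, hs⟩ := key (A.submatrix r id).transpose (by
    rw [Matrix.rank_transpose, hr.rank_matrix, Fintype.card_fin])
  rw [Matrix.linearIndependent_rows_iff_isUnit, Matrix.isUnit_iff_isUnit_det] at hs
  exact ⟨r, s, by simpa [← Matrix.det_transpose (A.submatrix r s)] using hs.ne_zero⟩

/-- If a minor of size `c` avoiding the row `a` is nonzero and all minors bordering it by `a`
vanish, then `a` is a combination of the rows of that minor. -/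
theorem Matrix.exists_vecMul_eq_of_bordered_minors {K ι : Type*} [Field K] {c : ℕ}
    (a : ι → K) (N : Matrix (Fin c) ι K) (s : Fin c → ι) (hs : (N.submatrix id s).det ≠ 0)
    (h : ∀ j, ((Matrix.of (Fin.cons a N : Fin (c + 1) → ι → K)).submatrix id
      (Fin.cons j s : Fin (c + 1) → ι)).det = 0) :
    ∃ v : Fin c → K, ∀ j, a j = ∑ i, v i * N i j := by
  let e : Unit ⊕ Fin c ≃ Fin (c + 1) :=
    (Equiv.sumComm _ _).trans ((Equiv.optionEquivSumPUnit _).symm.trans (finSuccEquiv c).symm)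
  let S := N.submatrix id s
  have hS : IsUnit S.det := isUnit_iff_ne_zero.2 hs
  have : Invertible S := S.invertibleOfIsUnitDet hS
  refine ⟨Matrix.vecMul (a ∘ s) S⁻¹, fun j => ?_⟩
  have h1 := h j
  have h2 : ((Matrix.of (Fin.cons a N : Fin (c + 1) → ι → K)).submatrix id
      (Fin.cons j s : Fin (c + 1) → ι)).submatrix e e =
      Matrix.fromBlocks (Matrix.of fun _ _ => a j) (Matrix.of fun _ l => a (s l))
        (Matrix.of fun i _ => N i j) S := by
    ext (p | p) (q | q) <;> simp [e, S] <;> rfl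
  rw [← Matrix.det_submatrix_equiv_self e, h2, Matrix.det_fromBlocks₂₂, mul_eq_zero,
    or_iff_right hS.ne_zero, Matrix.det_unique, Matrix.sub_apply, sub_eq_zero] at h1
  simpa [Matrix.mul_apply, Matrix.vecMul, dotProduct] using h1

/-- `n` algebraically independent elements, all algebraic over `n` elements `y`, dominate
everything algebraic over `y`. -/
theorem AlgebraicIndependent.isAlgebraic_of_card {k L ι κ : Type*} [Field k] [Field L] [Algebra k L]
    [Fintype ι] [Fintype κ] {η : ι → L} (hη : AlgebraicIndependent k η) (y : κ → L)
    (hcard : Fintype.card κ ≤ Fintype.card ι)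
    (h : ∀ i, IsAlgebraic (Algebra.adjoin k (Set.range y)) (η i)) {z : L}
    (hz : IsAlgebraic (Algebra.adjoin k (Set.range y)) z) :
    IsAlgebraic (Algebra.adjoin k (Set.range η)) z := by
  let M := AlgebraicIndependent.matroid k L
  have hind : M.Indep (Set.range η) := AlgebraicIndependent.matroid_indep_iff.2 hη.to_subtype_range
  have hsub : Set.range η ⊆ M.closure (Set.range y) := by
    rintro _ ⟨i, rfl⟩
    rw [AlgebraicIndependent.matroid_closure_eq]
    exact h i
  have hb := hind.isBasis_of_eRk_ge (Set.finite_range η) hsub (by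
    rw [M.eRk_closure_eq, hind.eRk_eq_encard, ← Set.image_univ, ← Set.image_univ,
      hη.injective.encard_image]
    refine (M.eRk_le_encard _).trans ((Set.encard_image_le _ _).trans ?_)
    simpa using hcard)
  have hz' : z ∈ M.closure (Set.range y) := by
    rw [AlgebraicIndependent.matroid_closure_eq]
    exact hz
  rw [← M.closure_closure, ← hb.closure_eq_closure, AlgebraicIndependent.matroid_closure_eq] at hz'
  exact hz'

/-- A homomorphism to an algebraically closed field extends along integral ring extensions. -/
theorem IsAlgClosed.exists_ringHom_of_isIntegral {R S k : Type*} [CommRing R] [CommRing S]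
    [Algebra R S] [Algebra.IsIntegral R S] [FaithfulSMul R S] [Field k] [IsAlgClosed k]
    (ψ : R →+* k) : ∃ φ : S →+* k, φ.comp (algebraMap R S) = ψ := by
  have hP : (RingHom.ker ψ).IsPrime := RingHom.ker_isPrime ψ
  obtain ⟨Q, hQ, hQP⟩ := Ideal.nonempty_primesOver (S := S) (RingHom.ker ψ)
  let ψ' : R ⧸ RingHom.ker ψ →+* k := RingHom.kerLift ψ
  let : Algebra (R ⧸ RingHom.ker ψ) k := ψ'.toAlgebra
  have hinj : Function.Injective (algebraMap (R ⧸ RingHom.ker ψ) k) := RingHom.kerLift_injective ψ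
  have : FaithfulSMul (R ⧸ RingHom.ker ψ) k := (faithfulSMul_iff_algebraMap_injective _ _).2 hinj
  have : Module.IsTorsionFree (R ⧸ RingHom.ker ψ) k := inferInstance
  have : FaithfulSMul (R ⧸ RingHom.ker ψ) (S ⧸ Q) := inferInstance
  have : Module.IsTorsionFree (R ⧸ RingHom.ker ψ) (S ⧸ Q) :=
    Module.isTorsionFree_iff_faithfulSMul.2 inferInstance
  let f : S ⧸ Q →ₐ[R ⧸ RingHom.ker ψ] k := IsAlgClosed.lift
  refine ⟨f.toRingHom.comp (Ideal.Quotient.mk Q), RingHom.ext fun a => ?_⟩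
  exact f.commutes (Ideal.Quotient.mk _ a)

theorem IsAlgClosed.mem_range_algebraMap_of_isAlgebraic {Ω L : Type*} [Field Ω] [IsAlgClosed Ω]
    [Field L] [Algebra Ω L] {a : L} (ha : IsAlgebraic Ω a) : a ∈ Set.range (algebraMap Ω L) :=
  minpoly.mem_range_of_degree_eq_one Ω a
    (IsAlgClosed.degree_eq_one_of_irreducible Ω (minpoly.irreducible ha.isIntegral))

/-- If the coordinate functions are algebraic on every irreducible subset of a zero locus, the zero
locus is finite. -/
theorem MvPolynomial.finite_zeroLocus_of_isAlgebraic {σ Ω : Type*} [Finite σ] [Field Ω]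
    [IsAlgClosed Ω] (I : Ideal (MvPolynomial σ Ω))
    (h : ∀ P : Ideal (MvPolynomial σ Ω), P.IsPrime → I ≤ P →
      ∀ i, IsAlgebraic Ω (algebraMap _ (FractionRing (MvPolynomial σ Ω ⧸ P))
        (Ideal.Quotient.mk P (X i)))) :
    (zeroLocus Ω I).Finite := by
  have hex : ∀ x : zeroLocus Ω I, ∃ P ∈ I.minimalPrimes, P ≤ vanishingIdeal Ω {x.1} := fun x =>
    Ideal.exists_minimalPrimes_le (by
      intro p hp
      simpa using x.2 p hp)
  choose f hf hle using hex
  have := (Ideal.finite_minimalPrimes_of_isNoetherianRing _ I).to_subtype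
  refine Set.finite_coe_iff.1 <| Finite.of_injective (fun x => (⟨f x, hf x⟩ : I.minimalPrimes)) ?_
  intro x y hxy
  have hxy : f x = f y := congrArg Subtype.val hxy
  have := (hf x).1.1
  ext i
  obtain ⟨c, hc⟩ :=
    IsAlgClosed.mem_range_algebraMap_of_isAlgebraic (h (f x) (hf x).1.1 (hf x).1.2 i)
  have hmem : X i - C c ∈ f x := by
    rw [← Ideal.Quotient.eq]
    apply IsFractionRing.injective (MvPolynomial σ Ω ⧸ f x) (FractionRing (MvPolynomial σ Ω ⧸ f x))
    exact hc.symm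
  have h1 := hle x hmem
  have h2 := hle y (hxy ▸ hmem)
  simp [sub_eq_zero] at h1 h2
  rw [h1, h2]

/-- Finitely many elements algebraic over a domain `A` specialize along every homomorphism from `A`
to an algebraically closed field at which a suitable nonzero element of `A` does not vanish. -/
theorem exists_ne_zero_forall_ringHom_extend {A Ω k : Type*} [CommRing A] [IsDomain A] [Field Ω]
    [Algebra A Ω] [FaithfulSMul A Ω] [Algebra.IsAlgebraic A Ω] [Field k] [IsAlgClosed k]
    (T : Finset Ω) : ∃ h : A, h ≠ 0 ∧ ∀ ψ : A →+* k, ψ h ≠ 0 →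
      ∃ (O : Subring Ω) (i : A →+* O) (φ : O →+* k), O.subtype.comp i = algebraMap A Ω ∧
        φ.comp i = ψ ∧ (T : Set Ω) ⊆ O := by
  obtain ⟨h, h0, hint⟩ := Algebra.IsAlgebraic.exists_integral_multiples A T
  refine ⟨h, h0, fun ψ hψ => ?_⟩
  obtain ⟨φ₀, hφ₀⟩ := IsAlgClosed.exists_ringHom_of_isIntegral (S := integralClosure A Ω) ψ
  let S := integralClosure A Ω
  let hS : S := algebraMap A S h
  have hΩ : algebraMap S Ω hS ≠ 0 := by
    rw [← IsScalarTower.algebraMap_apply]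
    simpa using h0
  let j : Localization.Away hS →+* Ω := IsLocalization.Away.lift hS (isUnit_iff_ne_zero.2 hΩ)
  have hjS : ∀ a, j (algebraMap S _ a) = a := fun a => IsLocalization.Away.lift_eq hS _ a
  have hjinj : Function.Injective j := by
    refine (IsLocalization.lift_injective_iff _).2 fun a b => ?_
    refine ⟨fun h => ?_, fun h => congrArg _ (Subtype.ext h)⟩
    have := congrArg j h
    rwa [hjS, hjS] at this
  let φ : Localization.Away hS →+* k := IsLocalization.Away.lift (g := φ₀) hS (by
    rw [isUnit_iff_ne_zero, ← RingHom.comp_apply, hφ₀]; exact hψ)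
  let e := RingEquiv.ofBijective j.rangeRestrict
    ⟨fun a b hab => hjinj (congrArg Subtype.val hab), j.rangeRestrict_surjective⟩
  refine ⟨j.range, e.toRingHom.comp ((algebraMap S _).comp (algebraMap A S)),
    φ.comp e.symm.toRingHom, ?_, ?_, ?_⟩
  · ext a
    exact hjS _
  · rw [← hφ₀]
    ext a
    simp [φ, S]
  · intro τ hτ
    refine ⟨IsLocalization.mk' _ (⟨h • τ, hint τ hτ⟩ : S)
      (⟨hS, Submonoid.mem_powers _⟩ : Submonoid.powers hS), ?_⟩
    apply mul_left_cancel₀ hΩ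
    have := congrArg j (IsLocalization.mk'_spec' (Localization.Away hS) (⟨h • τ, hint τ hτ⟩ : S)
      (⟨hS, Submonoid.mem_powers _⟩ : Submonoid.powers hS))
    rw [map_mul, hjS, hjS] at this
    exact this.trans (Algebra.smul_def h τ)

theorem IntermediateField.aeval_mem {k L σ : Type*} [Field k] [Field L] [Algebra k L]
    (K : IntermediateField k L) {x : σ → L} (hx : ∀ j, x j ∈ K) (p : MvPolynomial σ k) :
    aeval x p ∈ K := by
  have h : Algebra.adjoin k (Set.range x) ≤ K.toSubalgebra :=
    Algebra.adjoin_le (by rintro _ ⟨j, rfl⟩; exact hx j)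
  exact h (Algebra.adjoin_range_eq_range_aeval k x ▸ ⟨p, rfl⟩)

/-- Let `x` be a point at which `g` vanishes with a nonzero Jacobian minor. If an algebraically
independent tuple `η` differs from a tuple rational in `x` by a combination of the rows of the
Jacobian matrix, then `x` is algebraic over `η`. -/
theorem AlgebraicIndependent.isAlgebraic_of_eq_add_jacobian {k L σ : Type*} [Field k] [Field L]
    [Algebra k L] [Fintype σ] {c : ℕ} {η : σ → L} (hη : AlgebraicIndependent k η) (x : σ → L)
    (g : Fin c → MvPolynomial σ k) (s : Fin c → σ) (hg : ∀ i, aeval x (g i) = 0)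
    (hdet : (Matrix.of fun i j => aeval x (pderiv (s j) (g i))).det ≠ 0)
    (v : σ → L) (hv : ∀ j, v j ∈ IntermediateField.adjoin k (Set.range x)) (w : Fin c → L)
    (hw : ∀ j, v j - η j = ∑ i, w i * aeval x (pderiv j (g i))) (j : σ) :
    IsAlgebraic (Algebra.adjoin k (Set.range η)) (x j) := by
  classical
  have hsinj : Function.Injective s := by
    intro a b hab
    by_contra hne
    exact hdet (Matrix.det_zero_of_column_eq hne (by simp [hab]))
  let y : σ → L := Function.extend s w x
  let K := IntermediateField.adjoin k (Set.range y)
  have hyK : ∀ j, y j ∈ K := fun j => IntermediateField.subset_adjoin _ _ ⟨j, rfl⟩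
  let E := (algebraicClosure K L).restrictScalars k
  have hE : ∀ {a : L}, a ∈ E ↔ IsAlgebraic K a := mem_algebraicClosure_iff
  have hKE : ∀ a ∈ K, a ∈ E := fun a ha => hE.2 (isAlgebraic_algebraMap (⟨a, ha⟩ : K))
  have hx : ∀ j, x j ∈ E := fun j => hE.2 <|
    isAlgebraic_of_jacobian_minor_ne_zero x g s hg hdet K
      (fun j hj => by simpa [y, Function.extend_apply' _ _ _ hj] using hyK j) j
  have hw' : ∀ i, w i ∈ E := fun i => hKE _ (by
    simpa [y, hsinj.extend_apply] using hyK (s i))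
  have hv' : ∀ j, v j ∈ E := fun j =>
    (IntermediateField.adjoin_le_iff.2 (by rintro _ ⟨j, rfl⟩; exact hx j)) (hv j)
  have hηE : ∀ j, η j ∈ E := fun j => by
    rw [show η j = v j - ∑ i, w i * aeval x (pderiv j (g i)) by rw [← hw]; ring]
    exact sub_mem (hv' j) (sum_mem fun i _ => mul_mem (hw' i) (E.aeval_mem hx _))
  exact hη.isAlgebraic_of_card y le_rfl
    (fun i => IntermediateField.isAlgebraic_adjoin_iff.1 (hE.1 (hηE i)))
    (IntermediateField.isAlgebraic_adjoin_iff.1 (hE.1 (hx j)))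

/-- If the Jacobian matrix has rank `c` at every closed point of `V(g) \ V(F)`, then some minor of
size `c` is nonzero at every point of `V(g) \ V(F)` with values in an extension field. -/
theorem MvPolynomial.exists_jacobian_minor_ne_zero {k L : Type*} [Field k] [IsAlgClosed k] [Field L]
    [Algebra k L] {m l c : ℕ} (g : Fin l → MvPolynomial (Fin m) k) (F : MvPolynomial (Fin m) k)
    (hrank : ∀ x : Fin m → k, (∀ i, eval x (g i) = 0) → eval x F ≠ 0 →
      (Matrix.of fun i j => eval x (pderiv j (g i)) : Matrix (Fin l) (Fin m) k).rank = c)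
    (x : Fin m → L) (hg : ∀ i, aeval x (g i) = 0) (hF : aeval x F ≠ 0) :
    ∃ (r : Fin c → Fin l) (s : Fin c → Fin m),
      (Matrix.of fun i j => aeval x (pderiv (s j) (g (r i)))).det ≠ 0 := by
  by_contra! hdet
  let J (r : Fin c → Fin l) (s : Fin c → Fin m) : MvPolynomial (Fin m) k :=
    (Matrix.of fun i j => pderiv (s j) (g (r i))).det
  let I := Ideal.span (Set.range g ∪ Set.range fun p : _ × _ => J p.1 p.2)
  have hI : F ∈ I.radical := by
    rw [← vanishingIdeal_zeroLocus_eq_radical (K := k), mem_vanishingIdeal_iff]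
    intro z hz
    by_contra hFz
    have hz' : ∀ p ∈ Set.range g ∪ Set.range fun p : _ × _ => J p.1 p.2, aeval z p = 0 :=
      fun p hp => hz p (Ideal.subset_span hp)
    obtain ⟨r, s, hrs⟩ := Matrix.exists_submatrix_det_ne_zero_of_rank _
      (hrank z (fun i => by simpa [aeval_eq_eval] using hz' _ (.inl ⟨i, rfl⟩))
        (by simpa [aeval_eq_eval] using hFz))
    apply hrs
    have := hz' _ (.inr ⟨(r, s), rfl⟩)
    rw [AlgHom.map_det] at this
    exact this
  obtain ⟨N, hN⟩ := hI
  apply hF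
  have hle : I ≤ RingHom.ker (aeval x : MvPolynomial (Fin m) k →ₐ[k] L) := by
    refine Ideal.span_le.2 ?_
    rintro _ (⟨i, rfl⟩ | ⟨⟨r, s⟩, rfl⟩)
    · exact hg i
    · exact (AlgHom.map_det (aeval x) _).trans (hdet r s)
  have := hle hN
  rw [RingHom.mem_ker, map_pow] at this
  exact eq_zero_of_pow_eq_zero this

/-- A system of polynomial equations over a domain `A` with finitely many solutions over an
algebraic closure of the fraction field has the same number of solutions at generic specializations. -/
theorem MvPolynomial.exists_ncard_zeros_eq_of_finite {A Ω k σ ι : Type*} [CommRing A] [IsDomain A]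
    [Field Ω] [IsAlgClosed Ω] [Algebra A Ω] [FaithfulSMul A Ω] [Algebra.IsAlgebraic A Ω]
    [Field k] [IsAlgClosed k] [Finite σ] [Finite ι] (G : ι → MvPolynomial σ A)
    (hG : {x : σ → Ω | ∀ i, aeval x (G i) = 0}.Finite) :
    ∃ h : A, h ≠ 0 ∧ ∃ r : ℕ, ∀ ψ : A →+* k, ψ h ≠ 0 →
      {x : σ → k | ∀ i, eval₂ ψ x (G i) = 0}.Finite ∧
      {x : σ → k | ∀ i, eval₂ ψ x (G i) = 0}.ncard = r := by
  classical
  set P := {x : σ → Ω | ∀ i, aeval x (G i) = 0}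
  have := hG.fintype
  have := Fintype.ofFinite ι
  have hnull : ∀ J : P → σ, ∃ (N : ℕ) (B : ι → MvPolynomial σ Ω),
      ∑ i, B i * map (algebraMap A Ω) (G i) = (∏ p : P, (X (J p) - C (p.1 (J p)))) ^ N := by
    intro J
    have h : (∏ p : P, (X (J p) - C (p.1 (J p)))) ∈
        (Ideal.span (Set.range fun i => map (algebraMap A Ω) (G i))).radical := by
      rw [← vanishingIdeal_zeroLocus_eq_radical (K := Ω), mem_vanishingIdeal_iff]
      intro z hz
      have hzP : z ∈ P := fun i => by
        rw [← hz _ (Ideal.subset_span ⟨i, rfl⟩), aeval_map_algebraMap]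
      rw [map_prod]
      exact Finset.prod_eq_zero (Finset.mem_univ ⟨z, hzP⟩) (by simp)
    obtain ⟨N, hN⟩ := h
    obtain ⟨B, hB⟩ := Ideal.mem_span_range_iff_exists_fun.1 hN
    exact ⟨N, B, hB⟩
  choose N B hB using hnull
  let T : Set Ω := (Set.range fun q : P × σ => q.1.1 q.2) ∪
    (Set.range fun q : P × P × σ => (q.1.1 q.2.2 - q.2.1.1 q.2.2)⁻¹) ∪
    ⋃ q : (P → σ) × ι, ((B q.1 q.2).coeffs : Set Ω)
  have hT : T.Finite := ((Set.finite_range _).union (Set.finite_range _)).union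
    (Set.finite_iUnion fun _ => Finset.finite_toSet _)
  obtain ⟨h, h0, hψ⟩ := exists_ne_zero_forall_ringHom_extend (A := A) (k := k) hT.toFinset
  refine ⟨h, h0, Nat.card P, fun ψ hh => ?_⟩
  obtain ⟨O, i, φ, hi, hφ, hTO⟩ := hψ ψ hh
  rw [hT.coe_toFinset] at hTO
  let y (p : P) (j : σ) : O := ⟨p.1 j, hTO (.inl (.inl ⟨(p, j), rfl⟩))⟩
  have hlift : ∀ J l, ∃ b : MvPolynomial σ O, map O.subtype b = B J l := by
    intro J l
    refine mem_range_map_iff_coeffs_subset.2 fun a ha => ?_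
    exact ⟨⟨a, hTO (.inr (Set.mem_iUnion.2 ⟨(J, l), ha⟩))⟩, rfl⟩
  choose b hb using hlift
  have hid : ∀ J, ∑ l, b J l * map i (G l) = (∏ p : P, (X (J p) - C (y p (J p)))) ^ N J := by
    intro J
    apply map_injective O.subtype Subtype.val_injective
    simpa [hb, map_map, hi, y] using hB J
  let Φ (p : P) (j : σ) : k := φ (y p j)
  have hΦ : Function.Injective Φ := by
    intro p q hpq
    by_contra hne
    obtain ⟨j, hj⟩ := Function.ne_iff.1 (fun h => hne (Subtype.ext h))
    let u : O := ⟨(p.1 j - q.1 j)⁻¹, hTO (.inl (.inr ⟨(p, q, j), rfl⟩))⟩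
    have hu : (y p j - y q j) * u = 1 := Subtype.ext (mul_inv_cancel₀ (sub_ne_zero.2 hj))
    have := congrArg φ hu
    rw [map_mul, map_sub, sub_eq_zero.2 (congrFun hpq j), zero_mul, map_one] at this
    exact zero_ne_one this
  have hset : {x : σ → k | ∀ l, eval₂ ψ x (G l) = 0} = Set.range Φ := by
    ext x
    refine ⟨fun hx => ?_, ?_⟩
    · by_contra hne
      have : ∀ p, ∃ j, x j - Φ p j ≠ 0 := fun p => by
        obtain ⟨j, hj⟩ := Function.ne_iff.1 fun h : x = Φ p => hne ⟨p, h.symm⟩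
        exact ⟨j, sub_ne_zero.2 hj⟩
      choose J hJ using this
      have h1 := congrArg (eval₂Hom φ x) (hid J)
      simp only [map_sum, map_mul, map_pow, map_prod, map_sub, coe_eval₂Hom, eval₂_map, hφ,
        eval₂_X, eval₂_C] at h1
      rw [Finset.sum_eq_zero fun l _ => by rw [hx l, mul_zero]] at h1
      exact pow_ne_zero _ (Finset.prod_ne_zero_iff.2 fun p _ => hJ p) h1.symm
    · rintro ⟨p, rfl⟩ l
      have h1 : eval₂ i (y p) (G l) = 0 := by
        apply Subtype.val_injective
        have := eval₂_comp_left O.subtype i (y p) (G l)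
        rw [hi] at this
        exact this.trans (p.2 l)
      have := eval₂_comp_left φ i (y p) (G l)
      rw [h1, map_zero, hφ] at this
      exact this.symm
  rw [hset, ← Set.image_univ, Set.ncard_image_of_injective _ hΦ, Set.ncard_univ]
  exact ⟨Set.toFinite _, rfl⟩

/-- The matrix with first row `t ∇F - η` and remaining rows the Jacobian matrix of `g`, in
the unknowns `x` (the variables `some j`) and `t` (the variable `none`), over the polynomial
ring in the parameters `η`. -/
noncomputable def critMatrix {K : Type*} [CommRing K] {m k : ℕ} (g : Fin k → MvPolynomial (Fin m) K)
    (F : MvPolynomial (Fin m) K) :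
    Matrix (Fin (k + 1)) (Fin m) (MvPolynomial (Option (Fin m)) (MvPolynomial (Fin m) K)) :=
  Matrix.of (Fin.cons (fun j => X none * rename some (map C (pderiv j F)) - C (X j))
    fun i j => rename some (map C (pderiv j (g i))))

/-- The equations `g = 0`, `t F = 1` and the vanishing of the minors of size `r` of `critMatrix`. -/
noncomputable def critSystem {K : Type*} [CommRing K] {m k : ℕ} (r : ℕ)
    (g : Fin k → MvPolynomial (Fin m) K) (F : MvPolynomial (Fin m) K) :
    Fin k ⊕ Unit ⊕ ((Fin r → Fin (k + 1)) × (Fin r → Fin m)) →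
      MvPolynomial (Option (Fin m)) (MvPolynomial (Fin m) K) :=
  Sum.elim (fun i => rename some (map C (g i)))
    (Sum.elim (fun _ => X none * rename some (map C F) - 1)
      fun p => ((critMatrix g F).submatrix p.1 p.2).det)

theorem eval₂_critSystem_eq_zero_iff {K L : Type*} [CommRing K] [CommRing L] {m k r : ℕ}
    (g : Fin k → MvPolynomial (Fin m) K) (F : MvPolynomial (Fin m) K)
    (ψ : MvPolynomial (Fin m) K →+* L) (z : Option (Fin m) → L) :
    (∀ i, eval₂ ψ z (critSystem r g F i) = 0) ↔
      (∀ i, eval₂ (ψ.comp C) (z ∘ some) (g i) = 0) ∧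
      z none * eval₂ (ψ.comp C) (z ∘ some) F = 1 ∧
      ∀ (f : Fin r → Fin (k + 1)) (s : Fin r → Fin m),
        ((Matrix.of (Fin.cons
          (fun j => z none * eval₂ (ψ.comp C) (z ∘ some) (pderiv j F) - ψ (X j))
          fun i j => eval₂ (ψ.comp C) (z ∘ some) (pderiv j (g i)) :
            Fin (k + 1) → Fin m → L)).submatrix f s).det = 0 := by
  have hdet : ∀ f s, eval₂ ψ z ((critMatrix g F).submatrix f s).det = ((Matrix.of (Fin.cons
          (fun j => z none * eval₂ (ψ.comp C) (z ∘ some) (pderiv j F) - ψ (X j))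
          fun i j => eval₂ (ψ.comp C) (z ∘ some) (pderiv j (g i)) :
            Fin (k + 1) → Fin m → L)).submatrix f s : Matrix (Fin r) (Fin r) L).det := by
    intro f s
    rw [← coe_eval₂Hom, RingHom.map_det]
    congr 1
    ext p q
    simp only [RingHom.mapMatrix_apply, Matrix.map_apply, Matrix.submatrix_apply, critMatrix,
      Matrix.of_apply]
    refine Fin.cases ?_ (fun i => ?_) (f p) <;> simp [eval₂_rename, eval₂_map]
  simp only [critSystem, Sum.forall, Sum.elim_inl, Sum.elim_inr, Prod.forall, hdet]
  simp [eval₂_rename, eval₂_map, sub_eq_zero, eval₂_sub]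

/-- The solutions of `critSystem` with generic parameters `η` are algebraic over the field of
parameters. -/
theorem isAlgebraic_of_critSystem {K Ω L : Type*} [Field K] [IsAlgClosed K] {m k c : ℕ}
    (g : Fin k → MvPolynomial (Fin m) K) (F : MvPolynomial (Fin m) K)
    (hrank : ∀ x : Fin m → K, (∀ i, eval x (g i) = 0) → eval x F ≠ 0 →
      (Matrix.of fun i j => eval x (pderiv j (g i)) : Matrix (Fin k) (Fin m) K).rank = c)
    [Field Ω] [Algebra (MvPolynomial (Fin m) K) Ω] [FaithfulSMul (MvPolynomial (Fin m) K) Ω]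
    [Field L] [Algebra Ω L] (z : Option (Fin m) → L)
    (hz : ∀ i, eval₂ ((algebraMap Ω L).comp (algebraMap (MvPolynomial (Fin m) K) Ω)) z
      (critSystem (c + 1) g F i) = 0) (o : Option (Fin m)) :
    IsAlgebraic Ω (z o) := by
  let ψ := (algebraMap Ω L).comp (algebraMap (MvPolynomial (Fin m) K) Ω)
  have hψ : Function.Injective ψ :=
    (algebraMap Ω L).injective.comp (FaithfulSMul.algebraMap_injective _ _)
  let : Algebra K Ω := ((algebraMap (MvPolynomial (Fin m) K) Ω).comp C).toAlgebra
  let : Algebra K L := (ψ.comp C).toAlgebra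
  have : IsScalarTower K Ω L := .of_algebraMap_eq fun _ => rfl
  let ψ' : MvPolynomial (Fin m) K →ₐ[K] L := { ψ with commutes' := fun _ => rfl }
  let x := z ∘ some
  let η : Fin m → L := fun j => ψ (X j)
  have hη : AlgebraicIndependent K η :=
    (MvPolynomial.algebraicIndependent_X (Fin m) K).map' (f := ψ') hψ
  obtain ⟨hg, hF, hminor⟩ := (eval₂_critSystem_eq_zero_iff g F ψ z).1 hz
  replace hg : ∀ i, aeval x (g i) = 0 := hg
  replace hF : z none * aeval x F = 1 := hF
  obtain ⟨r, s, hrs⟩ := exists_jacobian_minor_ne_zero g F hrank x hg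
    (right_ne_zero_of_mul_eq_one hF)
  have hxK : ∀ j, x j ∈ IntermediateField.adjoin K (Set.range x) := fun j =>
    IntermediateField.subset_adjoin _ _ ⟨j, rfl⟩
  have ht : z none = (aeval x F)⁻¹ := eq_inv_of_mul_eq_one_left hF
  obtain ⟨w, hw⟩ := Matrix.exists_vecMul_eq_of_bordered_minors
    (fun j => z none * aeval x (pderiv j F) - η j)
    (Matrix.of fun i j => aeval x (pderiv j (g (r i)))) s hrs (fun j => by
      have := hminor (Fin.cons 0 (Fin.succ ∘ r)) (Fin.cons j s)
      rw [← this]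
      congr 1
      ext p q
      refine Fin.cases ?_ (fun i => ?_) p <;> simp <;> rfl)
  have halg := hη.isAlgebraic_of_eq_add_jacobian x (fun i => g (r i)) s (fun i => hg _) hrs
    (fun j => z none * aeval x (pderiv j F)) (fun j => by
      rw [ht]
      exact mul_mem (inv_mem (IntermediateField.aeval_mem _ hxK _))
        (IntermediateField.aeval_mem _ hxK _)) w hw
  let E := (algebraicClosure Ω L).restrictScalars K
  have hE : ∀ {a : L}, a ∈ E ↔ IsAlgebraic Ω a := mem_algebraicClosure_iff
  have hx : ∀ j, x j ∈ E := fun j => by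
    have h1 : Algebra.adjoin K (Set.range η) ≤ (IsScalarTower.toAlgHom K Ω L).range :=
      Algebra.adjoin_le (by rintro _ ⟨j, rfl⟩; exact ⟨algebraMap _ Ω (X j), rfl⟩)
    have h2 := (halg j).ringHom_of_comp_eq (Subalgebra.inclusion h1) (RingHom.id L)
      (Subalgebra.inclusion_injective h1) rfl
    exact hE.2 <| h2.of_ringHom_of_comp_eq (IsScalarTower.toAlgHom K Ω L).rangeRestrict
      (RingHom.id L) (AlgHom.rangeRestrict_surjective _) Function.injective_id rfl
  rw [← hE]
  cases o with
  | none => rw [ht]; exact inv_mem (E.aeval_mem hx _)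
  | some j => exact hx j

theorem finite_zeros_critSystem {K Ω : Type*} [Field K] [IsAlgClosed K] {m k c : ℕ}
    (g : Fin k → MvPolynomial (Fin m) K) (F : MvPolynomial (Fin m) K)
    (hrank : ∀ x : Fin m → K, (∀ i, eval x (g i) = 0) → eval x F ≠ 0 →
      (Matrix.of fun i j => eval x (pderiv j (g i)) : Matrix (Fin k) (Fin m) K).rank = c)
    [Field Ω] [IsAlgClosed Ω] [Algebra (MvPolynomial (Fin m) K) Ω]
    [FaithfulSMul (MvPolynomial (Fin m) K) Ω] :
    {x : Option (Fin m) → Ω | ∀ i, aeval x (critSystem (c + 1) g F i) = 0}.Finite := by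
  let I : Ideal (MvPolynomial (Option (Fin m)) Ω) :=
    Ideal.span (Set.range fun i => map (algebraMap _ Ω) (critSystem (c + 1) g F i))
  have hI : (zeroLocus Ω I).Finite := by
    refine finite_zeroLocus_of_isAlgebraic I fun P hP hIP o => ?_
    let L := FractionRing (MvPolynomial (Option (Fin m)) Ω ⧸ P)
    let θ : MvPolynomial (Option (Fin m)) Ω →ₐ[Ω] L :=
      (IsScalarTower.toAlgHom Ω _ L).comp (Ideal.Quotient.mkₐ Ω P)
    refine isAlgebraic_of_critSystem g F hrank (L := L) (fun o => θ (X o)) (fun i => ?_) o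
    have h1 : θ (map (algebraMap _ Ω) (critSystem (c + 1) g F i)) = 0 := by
      have : Ideal.Quotient.mk P (map (algebraMap _ Ω) (critSystem (c + 1) g F i)) = 0 :=
        Ideal.Quotient.eq_zero_iff_mem.2 (hIP (Ideal.subset_span ⟨i, rfl⟩))
      simp [θ, this]
    rw [← eval₂_map, ← aeval_def]
    rw [aeval_unique θ] at h1
    exact h1
  refine hI.subset fun x hx => ?_
  rw [zeroLocus_span]
  rintro _ ⟨i, rfl⟩
  rw [aeval_map_algebraMap]
  exact hx i

/-- Forgetting `t` identifies the solutions of `critSystem` at `η` with the critical points. -/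
theorem bijOn_crit {n k c : ℕ} (g : Fin k → MvPolynomial (Fin (n + 1)) ℂ)
    (F : MvPolynomial (Fin (n + 1)) ℂ) (η : Fin (n + 1) → ℂ) :
    Set.BijOn (fun z : Option (Fin (n + 1)) → ℂ => z ∘ some)
      {z | ∀ i, eval₂ (eval η) z (critSystem (c + 1) g F i) = 0} (Crit c g F η) := by
  have hC : (eval η).comp C = RingHom.id ℂ := by ext; simp
  have hmem : ∀ z : Option (Fin (n + 1)) → ℂ,
      (∀ i, eval₂ (eval η) z (critSystem (c + 1) g F i) = 0) ↔
        z ∘ some ∈ Crit c g F η ∧ z none = (eval (z ∘ some) F)⁻¹ := by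
    intro z
    rw [eval₂_critSystem_eq_zero_iff, hC]
    simp only [eval₂_id, eval_X]
    constructor
    · rintro ⟨hg, hF, hm⟩
      have ht := eq_inv_of_mul_eq_one_left hF
      refine ⟨⟨hg, right_ne_zero_of_mul_eq_one hF, fun f s _ _ => ?_⟩, ht⟩
      rw [ht] at hm
      exact hm f s
    · rintro ⟨⟨hg, hF, hm⟩, ht⟩
      rw [ht]
      refine ⟨hg, inv_mul_cancel₀ hF, fun f s => ?_⟩
      by_cases hf : Function.Injective f
      · by_cases hs : Function.Injective s
        · exact hm f s hf hs
        · obtain ⟨p, q, hpq, hne⟩ := Function.not_injective_iff.1 hs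
          exact Matrix.det_zero_of_column_eq hne fun i => by simp [hpq]
      · obtain ⟨p, q, hpq, hne⟩ := Function.not_injective_iff.1 hf
        exact Matrix.det_zero_of_row_eq hne (by ext j; simp [hpq])
  refine ⟨fun z hz => ((hmem z).1 hz).1, fun z hz w hw hzw => ?_, fun x hx => ?_⟩
  · ext o
    cases o with
    | none =>
      rw [((hmem z).1 hz).2, ((hmem w).1 hw).2]
      exact congrArg (fun x => (eval x F)⁻¹) hzw
    | some j => exact congrFun hzw j
  · exact ⟨fun o => o.elim (eval x F)⁻¹ x, (hmem _).2 ⟨hx, rfl⟩, rfl⟩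

/-- There is a nonzero polynomial h in η such that for all η with h(η) ≠ 0 the set of critical
points of ℓ_{F,η} on the punctured cone is finite, of cardinality independent of η: the maximum
likelihood degree MLD_X(F). -/
theorem stmt8 {n k c d : ℕ} (hc : c ≤ min k n) (hd : 1 ≤ d)
    (g : Fin k → MvPolynomial (Fin (n+1)) ℂ) (F : MvPolynomial (Fin (n+1)) ℂ)
    (hg : ∀ i, ∃ m, (g i).IsHomogeneous m) (hF : F.IsHomogeneous d)
    (hprime : (Ideal.span (Set.range g)).IsPrime)
    (hFnotin : F ∉ Ideal.span (Set.range g))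
    (hrank : ∀ x : Fin (n+1) → ℂ, (∀ i, eval x (g i) = 0) → eval x F ≠ 0 →
      (Matrix.of fun i j => eval x (pderiv j (g i)) : Matrix (Fin k) (Fin (n+1)) ℂ).rank = c) :
    ∃ h : MvPolynomial (Fin (n+1)) ℂ, h ≠ 0 ∧
      ∀ η η' : Fin (n+1) → ℂ, eval η h ≠ 0 → eval η' h ≠ 0 →
        (Crit c g F η).Finite ∧ (Crit c g F η').Finite ∧
          (Crit c g F η).ncard = (Crit c g F η').ncard := by
  let A := MvPolynomial (Fin (n + 1)) ℂ
  let Ω := AlgebraicClosure (FractionRing A)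
  have : FaithfulSMul A Ω := FaithfulSMul.trans A (FractionRing A) Ω
  have : Algebra.IsAlgebraic A Ω :=
    (IsFractionRing.comap_isAlgebraic_iff (K := FractionRing A)).2 inferInstance
  obtain ⟨h, h0, r, hr⟩ := exists_ncard_zeros_eq_of_finite (k := ℂ) (critSystem (c + 1) g F)
    (finite_zeros_critSystem g F hrank (Ω := Ω))
  have key : ∀ η, eval η h ≠ 0 → (Crit c g F η).Finite ∧ (Crit c g F η).ncard = r := by
    intro η hη
    obtain ⟨hfin, hcard⟩ := hr (eval η) hη
    have hbij := bijOn_crit (c := c) g F η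
    rw [← hbij.image_eq, hbij.injOn.ncard_image]
    exact ⟨hfin.image _, hcard⟩
  exact ⟨h, h0, fun η η' hη hη' =>
    ⟨(key η hη).1, (key η' hη').1, (key η hη).2.trans (key η' hη').2.symm⟩⟩
end

section
/- Let p ∈ ℂ^{n+1} satisfy g₁(p) = … = g_k(p) = 0 and F(p) = 1. Then ∇F(p) is not a ℂ-linear combination of ∇g₁(p), …, ∇g_k(p); consequently, the rank of the (k+1)×(n+1) Jacobian matrix of (g₁, …, g_k, F − 1) at p equals 1 + rank J_g(p). In particular, if the variety V(g₁, …, g_k) ⊆ ℙⁿ is smooth away from V(F) of codimension c, then the affine variety 𝕏_F = {x ∈ ℂ^{n+1} : g₁(x) = … = g_k(x) = 0, F(x) = 1} is smooth. -/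
open MvPolynomial

/-- Euler's identity at a point: `p ⬝ᵥ ∇P(p) = m P(p)` for `P` homogeneous of degree `m`. -/
theorem dotProduct_grad {n m : ℕ} {P : MvPolynomial (Fin (n+1)) ℂ} (hP : P.IsHomogeneous m)
    (p : Fin (n+1) → ℂ) : p ⬝ᵥ grad P p = m * eval p P := by
  simpa [dotProduct, grad] using congrArg (eval p) hP.sum_X_mul_pderiv

/-- Appending a row outside the row space increases the rank by one. -/
theorem Matrix.rank_of_snoc {K : Type*} [Field K] {k n : ℕ} (v : Fin k → Fin n → K)
    (w : Fin n → K) (hw : w ∉ Submodule.span K (Set.range v)) :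
    (Matrix.of (Fin.snoc v w) : Matrix (Fin (k+1)) (Fin n) K).rank =
      1 + (Matrix.of v).rank := by
  rw [Matrix.rank_eq_finrank_span_row, Matrix.rank_eq_finrank_span_row]
  change Module.finrank K (Submodule.span K (Set.range (Fin.snoc v w : Fin (k+1) → Fin n → K))) =
    1 + Module.finrank K (Submodule.span K (Set.range v))
  rw [Fin.range_snoc, Submodule.span_insert, sup_comm, Submodule.finrank_sup_span_singleton hw,
    add_comm]

/-- At a point p of 𝕏_F = {g₁ = … = g_k = 0, F = 1}, the gradient ∇F(p) is not a linear
combination of ∇g₁(p), …, ∇g_k(p); hence the Jacobian of (g₁, …, g_k, F − 1) at p has rank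
equal to 1 + rank J_g(p). (In particular 𝕏_F is smooth.) -/
theorem stmt9 {n k d : ℕ} (hd : 1 ≤ d)
    (g : Fin k → MvPolynomial (Fin (n+1)) ℂ) (F : MvPolynomial (Fin (n+1)) ℂ)
    (hg : ∀ i, ∃ m, (g i).IsHomogeneous m) (hF : F.IsHomogeneous d)
    (p : Fin (n+1) → ℂ)
    (hgp : ∀ i, eval p (g i) = 0) (hFp : eval p F = 1) :
    grad F p ∉ Submodule.span ℂ (Set.range fun i => grad (g i) p) ∧
    (Matrix.of (Fin.snoc (fun i => grad (g i) p) (grad F p)) :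
        Matrix (Fin (k+1)) (Fin (n+1)) ℂ).rank =
      1 + (Matrix.of fun i j => grad (g i) p j : Matrix (Fin k) (Fin (n+1)) ℂ).rank := by
  have hspan : grad F p ∉ Submodule.span ℂ (Set.range fun i => grad (g i) p) := by
    intro hmem
    have hle : Submodule.span ℂ (Set.range fun i => grad (g i) p) ≤
        LinearMap.ker (dotProductBilin ℂ ℂ p) := by
      rw [Submodule.span_le]
      rintro _ ⟨i, rfl⟩
      obtain ⟨m, hm⟩ := hg i
      simp [dotProduct_grad hm, hgp i]
    have hzero : p ⬝ᵥ grad F p = 0 := by simpa using hle hmem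
    rw [dotProduct_grad hF, hFp, mul_one, Nat.cast_eq_zero] at hzero
    omega
  exact ⟨hspan, Matrix.rank_of_snoc _ _ hspan⟩
end
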